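/- arXiv:1607.05101 — 2 statements merged into one kernel-verified Lean document; each statement's English description precedes it below -/
import Mathlib

section
/- Let D and D' be bounded domains in the complex plane ℂ, let p > 2, and let f : D → D' be a Q-homeomorphism with respect to the p-modulus, where Q ∈ L¹_loc(D \ {z₀}). Then for every r ∈ (0, d₀), where d₀ = dist(z₀, ∂D), the area of the image of the closed disc B(z₀, r) satisfies |f(B(z₀,r))| ≥ π · ((p−2)/(p−1))^{2(p−1)/(p−2)} · ( ∫₀^r dt / ( t^{1/(p−1)} · q_{z₀}(t)^{1/(p−1)} ) )^{2(p−1)/(p−2)}. -/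
open MeasureTheory Set Metric Complex ENNReal

noncomputable section

open Classical in
/-- The line integral `∫_γ ρ |dz|` of a Borel density `ρ` along a curve `γ`
(parametrized on `[0,1]`), with the convention that the integral is `∞`
for curves that are not rectifiable (here: not Lipschitz on `[0,1]`). -/
def lineIntegral (ρ : ℂ → ℝ≥0∞) (γ : ℝ → ℂ) : ℝ≥0∞ :=
  if ∃ K : NNReal, LipschitzOnWith K γ (Set.Icc 0 1) then
    ∫⁻ t in Set.Icc (0 : ℝ) 1, ρ (γ t) * (‖deriv γ t‖₊ : ℝ≥0∞)
  else ⊤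

/-- A Borel function `ρ : ℂ → [0,∞]` is admissible for the curve family `Γ`
if `∫_γ ρ |dz| ≥ 1` for every `γ ∈ Γ`. -/
def IsAdmissible (ρ : ℂ → ℝ≥0∞) (Γ : Set (ℝ → ℂ)) : Prop :=
  Measurable ρ ∧ ∀ γ ∈ Γ, 1 ≤ lineIntegral ρ γ

/-- The `p`-modulus of a family `Γ` of curves in `ℂ`:
`M_p(Γ) = inf { ∫_ℂ ρ^p dm : ρ admissible for Γ }`. -/
def pModulus (p : ℝ) (Γ : Set (ℝ → ℂ)) : ℝ≥0∞ :=
  ⨅ (ρ : ℂ → ℝ≥0∞) (_ : IsAdmissible ρ Γ), ∫⁻ z : ℂ, ρ z ^ p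

/-- `Γ` is a family of curves lying in the set `D`. -/
def CurveFamilyIn (Γ : Set (ℝ → ℂ)) (D : Set ℂ) : Prop :=
  ∀ γ ∈ Γ, ContinuousOn γ (Set.Icc 0 1) ∧ ∀ t ∈ Set.Icc (0 : ℝ) 1, γ t ∈ D

/-- `f` is a homeomorphism of `D` onto its image: continuous, injective and open on `D`. -/
def IsHomeoOn (f : ℂ → ℂ) (D : Set ℂ) : Prop :=
  ContinuousOn f D ∧ Set.InjOn f D ∧ ∀ U ⊆ D, IsOpen U → IsOpen (f '' U)

/-- `f` is a `Q`-homeomorphism with respect to the `p`-modulus on `D`: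
`M_p(fΓ) ≤ ∫_D Q(z) ρ(z)^p dm(z)` for every curve family `Γ` in `D` and every
`ρ` admissible for `Γ`. -/
def IsQHomeo (p : ℝ) (D : Set ℂ) (Q : ℂ → ℝ≥0∞) (f : ℂ → ℂ) : Prop :=
  IsHomeoOn f D ∧
    ∀ Γ : Set (ℝ → ℂ), CurveFamilyIn Γ D → ∀ ρ : ℂ → ℝ≥0∞, IsAdmissible ρ Γ →
      pModulus p ((fun γ => f ∘ γ) '' Γ) ≤ ∫⁻ z in D, Q z * ρ z ^ p

/-- The integral mean `q_{z₀}(r) = (1/(2πr)) ∫_{S(z₀,r)} Q(z) |dz|` of `Q` over the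
circle `S(z₀,r)`, computed via the arclength parametrization `θ ↦ z₀ + r e^{iθ}`. -/
def circleMean (Q : ℂ → ℝ≥0∞) (z₀ : ℂ) (r : ℝ) : ℝ≥0∞ :=
  (∫⁻ θ in Set.Icc (0 : ℝ) (2 * Real.pi),
      Q (z₀ + (r : ℂ) * Complex.exp ((θ : ℂ) * Complex.I))) / ENNReal.ofReal (2 * Real.pi)

theorem volume_add_volume_le_of_isCompact {X Y Z : Set ℝ} (hX : IsCompact X) (hY : IsCompact Y)
    (hXne : X.Nonempty) (hYne : Y.Nonempty) (hZ : ∀ x ∈ X, ∀ y ∈ Y, x + y ∈ Z) :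
    volume X + volume Y ≤ volume Z := by
  obtain ⟨a, haX, ha⟩ := hX.exists_isGreatest hXne
  obtain ⟨b, hbY, hb⟩ := hY.exists_isLeast hYne
  have h1 : volume ((fun x => x + b) '' X) = volume X := by
    simp
  have h2 : volume ((fun y => a + y) '' Y) = volume Y := by
    simp
  rw [← h1, ← h2, ← measure_union₀ (hY.image (by fun_prop)).measurableSet.nullMeasurableSet]
  · apply measure_mono
    rintro _ (⟨x, hx, rfl⟩ | ⟨y, hy, rfl⟩)
    · exact hZ x hx b hbY
    · exact hZ a haX y hy
  · refine measure_mono_null (t := {a + b}) ?_ (by simp)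
    rintro _ ⟨⟨x, hx, rfl⟩, ⟨y, hy, hxy⟩⟩
    have := ha hx
    have := hb hy
    simp only [mem_singleton_iff] at *
    linarith

/-- The one-dimensional Brunn–Minkowski inequality. -/
theorem volume_add_volume_le_of_add_mem {X Y Z : Set ℝ} (hX : MeasurableSet X)
    (hY : MeasurableSet Y) (hXne : X.Nonempty) (hYne : Y.Nonempty)
    (hZ : ∀ x ∈ X, ∀ y ∈ Y, x + y ∈ Z) : volume X + volume Y ≤ volume Z := by
  obtain ⟨x₀, hx₀⟩ := hXne
  obtain ⟨y₀, hy₀⟩ := hYne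
  rw [hX.measure_eq_iSup_isCompact, hY.measure_eq_iSup_isCompact]
  simp only [iSup_and']
  refine ENNReal.biSup_add_biSup_le' (p := fun K : Set ℝ => K ⊆ X ∧ IsCompact K)
    (q := fun K : Set ℝ => K ⊆ Y ∧ IsCompact K) ⟨∅, by simp⟩ ⟨∅, by simp⟩ ?_
  rintro K ⟨hKX, hK⟩ L ⟨hLY, hL⟩
  refine (add_le_add (measure_mono (subset_insert x₀ K)) (measure_mono (subset_insert y₀ L))).trans
    (volume_add_volume_le_of_isCompact (hK.insert x₀) (hL.insert y₀) (insert_nonempty _ _)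
      (insert_nonempty _ _) fun x hx y hy => hZ x ?_ y ?_)
  · exact insert_subset hx₀ hKX hx
  · exact insert_subset hy₀ hLY hy

theorem volume_eq_mul_lintegral_Ioo_section {A : Set (ℝ × ℝ)} (hA : MeasurableSet A)
    (hfin : ∀ x, volume (Prod.mk x ⁻¹' A) ≠ ⊤) {α : ℝ} (hα : 0 < α)
    (hle : ∀ x, (volume (Prod.mk x ⁻¹' A)).toReal ≤ α) :
    volume A = ENNReal.ofReal α * ∫⁻ s in Ioo (0 : ℝ) 1,
      volume {x : ℝ | s < (volume (Prod.mk x ⁻¹' A)).toReal / α} := by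
  have hm : Measurable fun x : ℝ => (volume (Prod.mk x ⁻¹' A)).toReal / α :=
    ((measurable_measure_prodMk_left hA).ennreal_toReal).div_const α
  have h := lintegral_eq_lintegral_meas_lt (volume : Measure ℝ)
    (f := fun x : ℝ => (volume (Prod.mk x ⁻¹' A)).toReal / α)
    (Filter.Eventually.of_forall fun x => by positivity) hm.aemeasurable
  have h2 : ∫⁻ s in Ioi (0 : ℝ), volume {x : ℝ | s < (volume (Prod.mk x ⁻¹' A)).toReal / α} =
      ∫⁻ s in Ioo (0 : ℝ) 1, volume {x : ℝ | s < (volume (Prod.mk x ⁻¹' A)).toReal / α} := by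
    rw [← lintegral_indicator measurableSet_Ioi, ← lintegral_indicator measurableSet_Ioo]
    congr 1
    ext s
    by_cases hs : s ∈ Ioo (0 : ℝ) 1
    · rw [indicator_of_mem hs, indicator_of_mem (show s ∈ Ioi (0 : ℝ) from hs.1)]
    · rw [indicator_of_notMem hs]
      by_cases hs0 : s ∈ Ioi (0 : ℝ)
      · rw [indicator_of_mem hs0]
        have h1s : 1 ≤ s := by
          by_contra hc
          exact hs ⟨hs0, not_le.1 hc⟩
        have : {x : ℝ | s < (volume (Prod.mk x ⁻¹' A)).toReal / α} = ∅ := by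
          ext x
          simp only [mem_ofPred_eq, mem_empty_iff_false, iff_false, not_lt]
          exact ((div_le_one hα).2 (hle x)).trans h1s
        rw [this, measure_empty]
      · rw [indicator_of_notMem hs0]
  rw [← h2, ← h, ← lintegral_const_mul _ hm.ennreal_ofReal, Measure.volume_eq_prod,
    Measure.prod_apply hA]
  refine lintegral_congr fun x => ?_
  rw [← ENNReal.ofReal_mul hα.le, mul_div_cancel₀ _ hα.ne', ENNReal.ofReal_toReal (hfin x)]

theorem exists_section_bound {A : Set (ℝ × ℝ)} (hA : Bornology.IsBounded A) :
    ∃ R : ℝ, 0 < R ∧ ∀ x, volume (Prod.mk x ⁻¹' A) ≤ ENNReal.ofReal R := by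
  obtain ⟨R, hR0, hR⟩ := hA.exists_pos_norm_le
  refine ⟨2 * R, by positivity, fun x => ?_⟩
  have : Prod.mk x ⁻¹' A ⊆ Icc (-R) R := fun y hy => by
    have := (norm_snd_le _).trans (hR _ hy)
    exact abs_le.1 this
  refine (measure_mono this).trans ?_
  rw [Real.volume_Icc]
  exact ENNReal.ofReal_le_ofReal (by linarith)

/-- The planar Brunn–Minkowski inequality `(√|A| + √|B|)² ≤ |A + B|`, proved by Bonnesen's
slicing argument. -/
theorem volume_add_add_sqrt_le_of_add_mem {A B C : Set (ℝ × ℝ)} (hA : MeasurableSet A)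
    (hB : MeasurableSet B) (hC : MeasurableSet C) (hAb : Bornology.IsBounded A)
    (hBb : Bornology.IsBounded B) (hCb : Bornology.IsBounded C) (hA0 : volume A ≠ 0)
    (hB0 : volume B ≠ 0) (hABC : ∀ a ∈ A, ∀ b ∈ B, a + b ∈ C) :
    (volume A).toReal + (volume B).toReal + 2 * √((volume A).toReal * (volume B).toReal) ≤
      (volume C).toReal := by
  obtain ⟨RA, hRA0, hRA⟩ := exists_section_bound hAb
  obtain ⟨RB, hRB0, hRB⟩ := exists_section_bound hBb
  obtain ⟨RC, hRC0, hRC⟩ := exists_section_bound hCb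
  have finA := fun x => ne_top_of_le_ne_top ENNReal.ofReal_ne_top (hRA x)
  have finB := fun x => ne_top_of_le_ne_top ENNReal.ofReal_ne_top (hRB x)
  have finC := fun x => ne_top_of_le_ne_top ENNReal.ofReal_ne_top (hRC x)
  set a : ℝ → ℝ := fun x => (volume (Prod.mk x ⁻¹' A)).toReal with ha
  set b : ℝ → ℝ := fun x => (volume (Prod.mk x ⁻¹' B)).toReal with hb
  set c : ℝ → ℝ := fun x => (volume (Prod.mk x ⁻¹' C)).toReal with hc
  have bddA : BddAbove (range a) := ⟨RA, by
    rintro _ ⟨x, rfl⟩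
    exact ENNReal.toReal_le_of_le_ofReal hRA0.le (hRA x)⟩
  have bddB : BddAbove (range b) := ⟨RB, by
    rintro _ ⟨x, rfl⟩
    exact ENNReal.toReal_le_of_le_ofReal hRB0.le (hRB x)⟩
  have pos : ∀ {E : Set (ℝ × ℝ)}, MeasurableSet E → volume E ≠ 0 →
      (∀ x, volume (Prod.mk x ⁻¹' E) ≠ ⊤) → ∃ x, 0 < (volume (Prod.mk x ⁻¹' E)).toReal := by
    intro E hE hE0 hfin
    by_contra! hcon
    apply hE0
    rw [Measure.volume_eq_prod, Measure.prod_apply hE]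
    refine (lintegral_congr fun x => ?_).trans lintegral_zero
    have := (ENNReal.toReal_eq_zero_iff _).1 (le_antisymm (hcon x) ENNReal.toReal_nonneg)
    exact this.resolve_right (hfin x)
  set α := ⨆ x, a x with hα
  set β := ⨆ x, b x with hβ
  have hα0 : 0 < α := by
    obtain ⟨x, hx⟩ := pos hA hA0 finA
    exact hx.trans_le (le_ciSup bddA x)
  have hβ0 : 0 < β := by
    obtain ⟨x, hx⟩ := pos hB hB0 finB
    exact hx.trans_le (le_ciSup bddB x)
  have eA := volume_eq_mul_lintegral_Ioo_section hA finA hα0 (fun x => le_ciSup bddA x)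
  have eB := volume_eq_mul_lintegral_Ioo_section hB finB hβ0 (fun x => le_ciSup bddB x)
  have ma : Measurable a := (measurable_measure_prodMk_left hA).ennreal_toReal
  have mb : Measurable b := (measurable_measure_prodMk_left hB).ennreal_toReal
  have mc : Measurable c := (measurable_measure_prodMk_left hC).ennreal_toReal
  set IA := ∫⁻ s in Ioo (0 : ℝ) 1, volume {x : ℝ | s < a x / α} with hIA
  set IB := ∫⁻ s in Ioo (0 : ℝ) 1, volume {x : ℝ | s < b x / β} with hIB
  have hab0 : 0 < α + β := by positivity
  have key : ENNReal.ofReal (α + β) * (IA + IB) ≤ volume C := by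
    have h1 : volume C = ENNReal.ofReal (α + β) * ∫⁻ s in Ioi (0 : ℝ),
        volume {x : ℝ | s < c x / (α + β)} := by
      rw [← lintegral_eq_lintegral_meas_lt (volume : Measure ℝ)
        (f := fun x : ℝ => c x / (α + β))
        (Filter.Eventually.of_forall fun x => div_nonneg ENNReal.toReal_nonneg hab0.le)
        (mc.div_const _).aemeasurable,
        ← lintegral_const_mul _ (mc.div_const _).ennreal_ofReal, Measure.volume_eq_prod,
        Measure.prod_apply hC]
      refine lintegral_congr fun x => ?_
      rw [← ENNReal.ofReal_mul hab0.le, mul_div_cancel₀ _ hab0.ne', ENNReal.ofReal_toReal (finC x)]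
    rw [h1]
    gcongr
    have manti : Measurable fun s => volume {x : ℝ | s < a x / α} :=
      Antitone.measurable fun s t hst => measure_mono fun x (hx : t < _) => hst.trans_lt hx
    rw [hIA, hIB, ← lintegral_add_left manti]
    refine (setLIntegral_mono' measurableSet_Ioo ?_).trans
      (lintegral_mono_set Ioo_subset_Ioi_self)
    intro s hs
    refine volume_add_volume_le_of_add_mem (measurableSet_lt measurable_const (ma.div_const _))
      (measurableSet_lt measurable_const (mb.div_const _)) ?_ ?_ ?_
    · obtain ⟨x, hx⟩ := exists_lt_of_lt_ciSup (show s * α < ⨆ x, a x by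
        rw [← hα]; nlinarith [hs.2])
      exact ⟨x, (lt_div_iff₀ hα0).2 hx⟩
    · obtain ⟨x, hx⟩ := exists_lt_of_lt_ciSup (show s * β < ⨆ x, b x by
        rw [← hβ]; nlinarith [hs.2])
      exact ⟨x, (lt_div_iff₀ hβ0).2 hx⟩
    · intro x hx y hy
      have hx' := (lt_div_iff₀ hα0).1 hx
      have hy' := (lt_div_iff₀ hβ0).1 hy
      have hxp : 0 < a x := (mul_pos hs.1 hα0).trans hx'
      have hyp : 0 < b y := (mul_pos hs.1 hβ0).trans hy'
      refine (lt_div_iff₀ hab0).2 ?_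
      have hne : ∀ {S : Set ℝ}, 0 < (volume S).toReal → S.Nonempty := fun {S} h => by
        rw [nonempty_iff_ne_empty]
        rintro rfl
        simp at h
      have hsum := volume_add_volume_le_of_add_mem (Z := Prod.mk (x + y) ⁻¹' C)
        (measurable_prodMk_left hA) (measurable_prodMk_left hB) (hne hxp) (hne hyp)
        (fun u hu w hw => hABC _ hu _ hw)
      have hsum' : a x + b y ≤ c (x + y) := by
        simp only [ha, hb, hc]
        rw [← ENNReal.toReal_add (finA x) (finB y)]
        exact ENNReal.toReal_mono (finC _) hsum
      linarith
  have finvC : volume C ≠ ⊤ := hCb.measure_lt_top.ne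
  have finvA : volume A ≠ ⊤ := hAb.measure_lt_top.ne
  have finvB : volume B ≠ ⊤ := hBb.measure_lt_top.ne
  have finIA : IA ≠ ⊤ := by
    intro h
    rw [h, ENNReal.mul_top (by simpa using hα0)] at eA
    exact finvA eA
  have finIB : IB ≠ ⊤ := by
    intro h
    rw [h, ENNReal.mul_top (by simpa using hβ0)] at eB
    exact finvB eB
  have key' := ENNReal.toReal_mono finvC key
  rw [ENNReal.toReal_mul, ENNReal.toReal_add finIA finIB, ENNReal.toReal_ofReal hab0.le] at key'
  rw [eA, eB, ENNReal.toReal_mul, ENNReal.toReal_mul, ENNReal.toReal_ofReal hα0.le,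
    ENNReal.toReal_ofReal hβ0.le]
  refine le_trans ?_ key'
  set i := IA.toReal
  set j := IB.toReal
  have hi : 0 ≤ i := ENNReal.toReal_nonneg
  have hj : 0 ≤ j := ENNReal.toReal_nonneg
  have hs : √(α * i * (β * j)) = √(α * j) * √(β * i) := by
    rw [← Real.sqrt_mul (by positivity)]
    congr 1
    ring
  rw [hs]
  nlinarith [sq_nonneg (√(α * j) - √(β * i)), Real.sq_sqrt (show 0 ≤ α * j by positivity),
    Real.sq_sqrt (show 0 ≤ β * i by positivity)]

/-- The value `2 √(π V)`: the perimeter of a disc of area `V`. -/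
def discPerimeter (V : ℝ≥0∞) : ℝ≥0∞ := ENNReal.ofReal (2 * √Real.pi) * V ^ (1 / 2 : ℝ)

/-- The planar isoperimetric inequality for the outer Minkowski content. -/
theorem volume_add_mul_discPerimeter_le_volume_thickening {E : Set ℂ} (hE : IsOpen E)
    (hEb : Bornology.IsBounded E) {ε : ℝ} (hε : 0 < ε) :
    volume E + ENNReal.ofReal ε * discPerimeter (volume E) ≤ volume (thickening ε E) := by
  rcases E.eq_empty_or_nonempty with rfl | hne
  · simp [discPerimeter]
  have hmp := Complex.volume_preserving_equiv_real_prod.symm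
  have hfin : volume E ≠ ⊤ := hEb.measure_lt_top.ne
  have hTb : Bornology.IsBounded (thickening ε E) := hEb.thickening
  have hTfin : volume (thickening ε E) ≠ ⊤ := hTb.measure_lt_top.ne
  have bdd : ∀ {S : Set ℂ}, Bornology.IsBounded S →
      Bornology.IsBounded (Complex.measurableEquivRealProd.symm ⁻¹' S) := by
    intro S hS
    obtain ⟨R, hR⟩ := hS.exists_norm_le
    refine (Metric.isBounded_closedBall (x := (0 : ℝ × ℝ)) (r := R)).subset fun x hx => ?_
    have h := hR _ hx
    rw [mem_closedBall_zero_iff, Prod.norm_def]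
    exact max_le ((Complex.abs_re_le_norm _).trans h) ((Complex.abs_im_le_norm _).trans h)
  have meas : ∀ {S : Set ℂ}, IsOpen S →
      MeasurableSet (Complex.measurableEquivRealProd.symm ⁻¹' S) := fun hS =>
    Complex.measurableEquivRealProd.symm.measurable hS.measurableSet
  have vol : ∀ {S : Set ℂ}, IsOpen S →
      volume (Complex.measurableEquivRealProd.symm ⁻¹' S) = volume S := fun hS =>
    hmp.measure_preimage hS.measurableSet.nullMeasurableSet
  have hb : volume (ball (0 : ℂ) ε) = ENNReal.ofReal (Real.pi * ε ^ 2) := by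
    rw [Complex.volume_ball, mul_comm, ENNReal.ofReal_mul Real.pi_pos.le,
      ENNReal.ofReal_pow hε.le]
    congr 1
    rw [← NNReal.coe_real_pi, ENNReal.ofReal_coe_nnreal]
  have h := volume_add_add_sqrt_le_of_add_mem (meas hE) (meas (isOpen_ball (x := (0 : ℂ)) (ε := ε)))
    (meas (isOpen_thickening (E := E) (δ := ε))) (bdd hEb) (bdd isBounded_ball) (bdd hTb)
    (by rw [vol hE]; exact (hE.measure_pos volume hne).ne')
    (by rw [vol isOpen_ball]; exact (measure_ball_pos volume _ hε).ne') (by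
      intro a ha b hb
      rw [mem_preimage, mem_thickening_iff]
      refine ⟨_, ha, ?_⟩
      have hb' := mem_ball_zero_iff.1 hb
      have hsub : Complex.measurableEquivRealProd.symm (a + b) -
          Complex.measurableEquivRealProd.symm a = Complex.measurableEquivRealProd.symm b := by
        apply Complex.ext <;> simp [Complex.measurableEquivRealProd]
      rwa [dist_eq_norm, hsub])
  rw [vol hE, vol isOpen_ball, vol isOpen_thickening, hb,
    ENNReal.toReal_ofReal (by positivity)] at h
  set V := (volume E).toReal with hV
  have hV0 : 0 ≤ V := ENNReal.toReal_nonneg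
  have e1 : discPerimeter (volume E) = ENNReal.ofReal (2 * √Real.pi * √V) := by
    rw [discPerimeter, ENNReal.ofReal_mul (p := 2 * √Real.pi) (by positivity), Real.sqrt_eq_rpow V,
      ← ENNReal.ofReal_rpow_of_nonneg hV0 (by norm_num), hV, ENNReal.ofReal_toReal hfin]
  have e2 : √(V * (Real.pi * ε ^ 2)) = ε * √Real.pi * √V := by
    rw [Real.sqrt_mul hV0, Real.sqrt_mul Real.pi_pos.le, Real.sqrt_sq hε.le]
    ring
  rw [e1, ← ENNReal.ofReal_mul hε.le, ← ENNReal.ofReal_toReal hfin, ← ENNReal.ofReal_toReal hTfin,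
    ← hV, ← ENNReal.ofReal_add hV0 (by positivity)]
  apply ENNReal.ofReal_le_ofReal
  rw [e2] at h
  have : 0 ≤ Real.pi * ε ^ 2 := by positivity
  linarith

/-- The weight `1 / P(t)`, where `P(t)` is the perimeter of a disc having the same area as the
sublevel set `{v ≤ t}`. -/
def isoWeight (v : ℂ → ℝ) (t : ℝ) : ℝ≥0∞ := (discPerimeter (volume {x | v x ≤ t}))⁻¹

theorem discPerimeter_mono : Monotone discPerimeter := fun _ _ h => by
  unfold discPerimeter
  gcongr

theorem continuous_discPerimeter : Continuous discPerimeter :=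
  (ENNReal.continuous_const_mul ENNReal.ofReal_ne_top).comp ENNReal.continuous_rpow_const

theorem discPerimeter_ne_zero {V : ℝ≥0∞} (hV : V ≠ 0) : discPerimeter V ≠ 0 := by
  have := Real.pi_pos
  refine mul_ne_zero (by simpa using this) ?_
  simp [ENNReal.rpow_eq_zero_iff, hV]

theorem discPerimeter_ne_top {V : ℝ≥0∞} (hV : V ≠ ⊤) : discPerimeter V ≠ ⊤ :=
  ENNReal.mul_ne_top ENNReal.ofReal_ne_top (ENNReal.rpow_ne_top_of_nonneg (by norm_num) hV)

theorem isoWeight_antitone (v : ℂ → ℝ) : Antitone (isoWeight v) := fun _ _ hst =>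
  ENNReal.inv_le_inv.2 (discPerimeter_mono (measure_mono fun _ hx => le_trans hx hst))

theorem tendsto_isoWeight_add {v : ℂ → ℝ} (hv : Continuous v) {t : ℝ} (ht : t < 1)
    (hfin : volume {x | v x < 1} ≠ ⊤) :
    Filter.Tendsto (fun n : ℕ => isoWeight v (t + 1 / ((n : ℝ) + 1))) Filter.atTop
      (nhds (isoWeight v t)) := by
  have h1 : Filter.Tendsto (fun n : ℕ => volume {x | v x ≤ t + 1 / ((n : ℝ) + 1)}) Filter.atTop
      (nhds (volume (⋂ n : ℕ, {x | v x ≤ t + 1 / ((n : ℝ) + 1)}))) := by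
    refine tendsto_measure_iInter_atTop
      (fun n => (isClosed_le hv continuous_const).measurableSet.nullMeasurableSet) ?_ ?_
    · intro m n hmn x hx
      refine le_trans (show v x ≤ _ from hx) ?_
      have := one_div_le_one_div_of_le (by positivity : (0 : ℝ) < m + 1)
        (by gcongr : (m : ℝ) + 1 ≤ n + 1)
      linarith
    · obtain ⟨n, hn⟩ := exists_nat_one_div_lt (sub_pos.2 ht)
      refine ⟨n, ne_top_of_le_ne_top hfin (measure_mono fun x hx => ?_)⟩
      have : v x ≤ t + 1 / ((n : ℝ) + 1) := hx
      show v x < 1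
      linarith
  have h2 : (⋂ n : ℕ, {x | v x ≤ t + 1 / ((n : ℝ) + 1)}) = {x | v x ≤ t} := by
    ext x
    simp only [mem_iInter, mem_ofPred_eq]
    refine ⟨fun h => ?_, fun h n => h.trans (by simp; positivity)⟩
    refine le_of_forall_pos_lt_add fun ε hε => ?_
    obtain ⟨n, hn⟩ := exists_nat_one_div_lt hε
    linarith [h n]
  rw [h2] at h1
  exact ((continuous_inv.comp continuous_discPerimeter).tendsto _).comp h1

theorem ae_volume_sublevel_eq {v : ℂ → ℝ} (hv : Continuous v) :
    ∀ᵐ t : ℝ, volume {x | v x < t} = volume {x | v x ≤ t} := by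
  have h := (Measure.countable_meas_level_set_pos (μ := (volume : Measure ℂ)) hv.measurable).ae_notMem
    (volume : Measure ℝ)
  filter_upwards [h] with t ht
  have h0 : volume {x | v x = t} = 0 := by
    simpa using ht
  refine le_antisymm (measure_mono fun x (hx : v x < t) => hx.le) ?_
  calc volume {x | v x ≤ t} ≤ volume ({x | v x < t} ∪ {x | v x = t}) :=
        measure_mono fun x (hx : v x ≤ t) => lt_or_eq_of_le hx
    _ ≤ _ := (measure_union_le _ _).trans (by rw [h0, add_zero])

theorem lintegral_isoWeight_add_le {v ρ : ℂ → ℝ} {Λ M ε σ : ℝ} (hv : Continuous v)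
    (hbdd : Bornology.IsBounded {x | v x < 1}) (hρ : Continuous ρ) (hρ0 : ∀ x, 0 ≤ ρ x)
    (hρM : ∀ x, ρ x ≤ M) (hΛ : 0 ≤ Λ)
    (hlip : ∀ x y, v x ≤ v y + dist y x * (ρ x + Λ * dist y x)) (hε : 0 < ε)
    (hεσ : ε * (M + Λ * ε) ≤ σ) :
    ∫⁻ t in Ioo (0 : ℝ) 1, isoWeight v (t + σ) * discPerimeter (volume {x | v x < t}) ≤
      ∫⁻ x, ENNReal.ofReal (ρ x + Λ * ε) * isoWeight v (v x) := by
  set S : Set (ℂ × ℝ) := {q | q.2 ≤ v q.1 ∧ ∃ y, dist y q.1 < ε ∧ v y < q.2} with hS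
  have hSm : MeasurableSet S := by
    refine (measurableSet_le measurable_snd (hv.measurable.comp measurable_fst)).inter ?_
    have : {q : ℂ × ℝ | ∃ y, dist y q.1 < ε ∧ v y < q.2} =
        ⋃ y, ball y ε ×ˢ Ioi (v y) := by
      ext q
      simp [dist_comm]
    change MeasurableSet {q : ℂ × ℝ | ∃ y, dist y q.1 < ε ∧ v y < q.2}
    rw [this]
    exact (isOpen_iUnion fun y => isOpen_ball.prod isOpen_Ioi).measurableSet
  have hgm : Measurable (isoWeight v) := (isoWeight_antitone v).measurable
  have hgm' : Measurable fun q : ℂ × ℝ => S.indicator (fun q => isoWeight v (q.2 + σ)) q :=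
    (hgm.comp (measurable_snd.add_const σ)).indicator hSm
  have lower : ∀ t ∈ Ioo (0 : ℝ) 1,
      ENNReal.ofReal ε * (isoWeight v (t + σ) * discPerimeter (volume {x | v x < t})) ≤
        ∫⁻ x, S.indicator (fun q => isoWeight v (q.2 + σ)) (x, t) := by
    intro t ht
    have hE : Bornology.IsBounded {x | v x < t} :=
      hbdd.subset fun x (hx : v x < t) => hx.trans ht.2
    have hiso := volume_add_mul_discPerimeter_le_volume_thickening
      (isOpen_lt hv continuous_const : IsOpen {x | v x < t}) hE hε
    have e : ∀ x, S.indicator (fun q => isoWeight v (q.2 + σ)) (x, t) =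
        {x | (x, t) ∈ S}.indicator (fun _ => isoWeight v (t + σ)) x := fun x => by
      by_cases hx : (x, t) ∈ S
      · rw [indicator_of_mem hx, indicator_of_mem (show x ∈ {x | (x, t) ∈ S} from hx)]
      · rw [indicator_of_notMem hx, indicator_of_notMem (show x ∉ {x | (x, t) ∈ S} from hx)]
    simp_rw [e]
    have hSt : MeasurableSet {x | (x, t) ∈ S} := measurable_prodMk_right hSm
    rw [lintegral_indicator_const hSt]
    have hsub : thickening ε {x | v x < t} ⊆ {x | v x < t} ∪ {x | (x, t) ∈ S} := by
      intro x hx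
      by_cases hxt : v x < t
      · exact Or.inl hxt
      · obtain ⟨y, hy, hxy⟩ := mem_thickening_iff.1 hx
        exact Or.inr ⟨not_lt.1 hxt, y, by rwa [dist_comm], hy⟩
    have h1 := hiso.trans ((measure_mono hsub).trans (measure_union_le _ _))
    have h2 := (ENNReal.add_le_add_iff_left hE.measure_lt_top.ne).1 h1
    calc _ = isoWeight v (t + σ) * (ENNReal.ofReal ε * discPerimeter (volume {x | v x < t})) := by
          ring
      _ ≤ _ := by gcongr
  have upper : ∀ x, ∫⁻ t in Ioo (0 : ℝ) 1, S.indicator (fun q => isoWeight v (q.2 + σ)) (x, t) ≤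
      ENNReal.ofReal ε * (ENNReal.ofReal (ρ x + Λ * ε) * isoWeight v (v x)) := by
    intro x
    have hL0 : 0 ≤ ρ x + Λ * ε := add_nonneg (hρ0 x) (by positivity)
    have hle : ∀ t, S.indicator (fun q => isoWeight v (q.2 + σ)) (x, t) ≤
        (Icc (v x - ε * (ρ x + Λ * ε)) (v x)).indicator (fun _ => isoWeight v (v x)) t := by
      intro t
      by_cases hx : (x, t) ∈ S
      · obtain ⟨htx, y, hy, hyt⟩ := hx
        simp only at htx hy hyt
        have h3 : v x ≤ t + ε * (ρ x + Λ * ε) := by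
          refine (hlip x y).trans (add_le_add hyt.le ?_)
          have := hρ0 x
          gcongr
        rw [indicator_of_mem (show (x, t) ∈ S from ⟨htx, y, hy, hyt⟩), indicator_of_mem]
        · apply isoWeight_antitone
          have : ε * (ρ x + Λ * ε) ≤ ε * (M + Λ * ε) := by
            gcongr
            exact hρM x
          simp only
          linarith
        · exact ⟨by linarith, htx⟩
      · rw [indicator_of_notMem hx]
        exact zero_le
    calc _ ≤ ∫⁻ t, S.indicator (fun q => isoWeight v (q.2 + σ)) (x, t) := setLIntegral_le_lintegral _ _
      _ ≤ _ := lintegral_mono hle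
      _ = _ := by
        rw [lintegral_indicator_const measurableSet_Icc, Real.volume_Icc, _root_.sub_sub_cancel,
          ENNReal.ofReal_mul hε.le]
        ring
  have hVm : Measurable fun t => discPerimeter (volume {x | v x < t}) :=
    Monotone.measurable fun s t hst =>
      discPerimeter_mono (measure_mono fun x (hx : v x < s) => hx.trans_le hst)
  have hgσ : Measurable fun t => isoWeight v (t + σ) := hgm.comp (measurable_id.add_const σ)
  have hgv : Measurable fun x => isoWeight v (v x) := hgm.comp hv.measurable
  have hm1 : Measurable fun t => isoWeight v (t + σ) * discPerimeter (volume {x | v x < t}) :=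
    hgσ.mul hVm
  have hm2 : Measurable fun x => ENNReal.ofReal (ρ x + Λ * ε) * isoWeight v (v x) :=
    (hρ.measurable.add_const _).ennreal_ofReal.mul hgv
  have main : ENNReal.ofReal ε *
      ∫⁻ t in Ioo (0 : ℝ) 1, isoWeight v (t + σ) * discPerimeter (volume {x | v x < t}) ≤
      ENNReal.ofReal ε * ∫⁻ x, ENNReal.ofReal (ρ x + Λ * ε) * isoWeight v (v x) := by
    rw [← lintegral_const_mul _ hm1, ← lintegral_const_mul _ hm2]
    refine (setLIntegral_mono' measurableSet_Ioo lower).trans ?_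
    rw [lintegral_lintegral_swap]
    · exact lintegral_mono upper
    · exact (hgm'.comp measurable_swap).aemeasurable
  exact (ENNReal.mul_le_mul_iff_right (by simpa using hε) ENNReal.ofReal_ne_top).1 main

/-- A weighted `L¹` lower bound for an upper gradient `ρ` of `v`, combining the coarea and the
isoperimetric inequalities. -/
theorem one_le_lintegral_mul_isoWeight {v ρ : ℂ → ℝ} {Λ M : ℝ} {c : ℂ} (hv : Continuous v)
    (hbdd : Bornology.IsBounded {x | v x < 1}) (hvc : v c ≤ 0)
    (hρ : Continuous ρ) (hρ0 : ∀ x, 0 ≤ ρ x)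
    (hρM : ∀ x, ρ x ≤ M) (hΛ : 0 ≤ Λ)
    (hlip : ∀ x y, v x ≤ v y + dist y x * (ρ x + Λ * dist y x))
    (hfin : ∫⁻ x, isoWeight v (v x) ≠ ⊤) :
    1 ≤ ∫⁻ x, ENNReal.ofReal (ρ x) * isoWeight v (v x) := by
  have hM0 : 0 ≤ M := (hρ0 0).trans (hρM 0)
  have hgm : Measurable (isoWeight v) := (isoWeight_antitone v).measurable
  have hVm : Measurable fun t => discPerimeter (volume {x | v x < t}) :=
    Monotone.measurable fun s t hst =>
      discPerimeter_mono (measure_mono fun x (hx : v x < s) => hx.trans_le hst)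
  have hgv : Measurable fun x => isoWeight v (v x) := hgm.comp hv.measurable
  have step : ∀ n : ℕ, ∫⁻ t in Ioo (0 : ℝ) 1,
      isoWeight v (t + 1 / ((n : ℝ) + 1)) * discPerimeter (volume {x | v x < t}) ≤
      ∫⁻ x, ENNReal.ofReal (ρ x) * isoWeight v (v x) := by
    intro n
    set σ : ℝ := 1 / ((n : ℝ) + 1) with hσ
    have hσ0 : 0 < σ := by positivity
    have hlim : Filter.Tendsto (fun ε : ℝ => (∫⁻ x, ENNReal.ofReal (ρ x) * isoWeight v (v x)) +
        ENNReal.ofReal (Λ * ε) * ∫⁻ x, isoWeight v (v x)) (nhdsWithin 0 (Ioi 0))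
        (nhds (∫⁻ x, ENNReal.ofReal (ρ x) * isoWeight v (v x))) := by
      have hc : Continuous fun ε : ℝ => (∫⁻ x, ENNReal.ofReal (ρ x) * isoWeight v (v x)) +
          ENNReal.ofReal (Λ * ε) * ∫⁻ x, isoWeight v (v x) := by
        refine continuous_const.add ((ENNReal.continuous_mul_const hfin).comp ?_)
        exact ENNReal.continuous_ofReal.comp (by fun_prop)
      have := (hc.tendsto 0).mono_left (nhdsWithin_le_nhds (s := Ioi 0))
      simpa using this
    have hsmall : ∀ᶠ ε in nhdsWithin (0 : ℝ) (Ioi 0), ε * (M + Λ * ε) ≤ σ := by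
      have hc : Continuous fun ε : ℝ => ε * (M + Λ * ε) := by fun_prop
      have := (hc.tendsto 0).mono_left (nhdsWithin_le_nhds (s := Ioi 0))
      simp only [zero_mul] at this
      exact (this.eventually (gt_mem_nhds hσ0)).mono fun _ h => le_of_lt h
    refine ge_of_tendsto hlim ?_
    filter_upwards [hsmall, self_mem_nhdsWithin] with ε hε hε0
    refine (lintegral_isoWeight_add_le hv hbdd hρ hρ0 hρM hΛ hlip hε0 hε).trans_eq ?_
    have hε0' : (0 : ℝ) ≤ Λ * ε := mul_nonneg hΛ (le_of_lt hε0)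
    have hm : Measurable fun x => ENNReal.ofReal (ρ x) * isoWeight v (v x) :=
      hρ.measurable.ennreal_ofReal.mul hgv
    rw [← lintegral_const_mul _ hgv, ← lintegral_add_left hm]
    refine lintegral_congr fun x => ?_
    rw [ENNReal.ofReal_add (hρ0 x) hε0', add_mul]
  have hone : (1 : ℝ≥0∞) = ∫⁻ t in Ioo (0 : ℝ) 1, 1 := by simp
  rw [hone]
  calc ∫⁻ t in Ioo (0 : ℝ) 1, (1 : ℝ≥0∞) ≤ ∫⁻ t in Ioo (0 : ℝ) 1,
        Filter.liminf (fun n : ℕ => isoWeight v (t + 1 / ((n : ℝ) + 1)) *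
          discPerimeter (volume {x | v x < t})) Filter.atTop := by
        refine lintegral_mono_ae ?_
        filter_upwards [ae_restrict_of_ae (ae_volume_sublevel_eq hv),
          ae_restrict_mem measurableSet_Ioo] with t ht ht01
        have hE : Bornology.IsBounded {x | v x < t} :=
          hbdd.subset fun x (hx : v x < t) => hx.trans ht01.2
        have h0 : volume {x | v x < t} ≠ 0 :=
          ((isOpen_lt hv continuous_const).measure_pos volume ⟨c, hvc.trans_lt ht01.1⟩).ne'
        have h3 := ENNReal.Tendsto.mul_const (b := discPerimeter (volume {x | v x < t}))
          (tendsto_isoWeight_add hv ht01.2 hbdd.measure_lt_top.ne)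
          (Or.inr (discPerimeter_ne_top hE.measure_lt_top.ne))
        rw [h3.liminf_eq, isoWeight, ← ht, ENNReal.inv_mul_cancel (discPerimeter_ne_zero h0)
          (discPerimeter_ne_top hE.measure_lt_top.ne)]
    _ ≤ Filter.liminf (fun n : ℕ => ∫⁻ t in Ioo (0 : ℝ) 1, isoWeight v (t + 1 / ((n : ℝ) + 1)) *
          discPerimeter (volume {x | v x < t})) Filter.atTop :=
        lintegral_liminf_le fun n => (hgm.comp (measurable_id.add_const _)).mul hVm
    _ ≤ _ := by
        refine Filter.liminf_le_of_frequently_le' (Filter.Frequently.of_forall fun n => step n)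

theorem volume_setOf_volume_sublevel_le (v : ℂ → ℝ) (s : ℝ≥0∞) :
    volume {x | volume {y | v y ≤ v x} ≤ s} ≤ s := by
  by_cases hmax : ∃ a, volume {y | v y ≤ a} ≤ s ∧ ∀ t, volume {y | v y ≤ t} ≤ s → t ≤ a
  · obtain ⟨a, ha, hmax⟩ := hmax
    exact (measure_mono fun x hx => hmax _ hx).trans ha
  · push Not at hmax
    have hsub : {x | volume {y | v y ≤ v x} ≤ s} ⊆
        ⋃ q : {q : ℚ // volume {y | v y ≤ (q : ℝ)} ≤ s}, {y | v y ≤ ((q : ℚ) : ℝ)} := by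
      intro x hx
      obtain ⟨t, ht, hxt⟩ := hmax _ hx
      obtain ⟨q, hq1, hq2⟩ := exists_rat_btwn hxt
      exact mem_iUnion.2 ⟨⟨q, (measure_mono fun y (hy : v y ≤ q) => hy.trans hq2.le).trans ht⟩,
        hq1.le⟩
    refine (measure_mono hsub).trans ?_
    rw [Directed.measure_iUnion]
    · exact iSup_le fun q => q.2
    · refine Monotone.directed_le fun q q' hqq y hy => ?_
      have h1 : v y ≤ ((q : ℚ) : ℝ) := hy
      have h2 : ((q : ℚ) : ℝ) ≤ ((q' : ℚ) : ℝ) := by exact_mod_cast hqq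
      exact h1.trans h2

theorem lintegral_rpow_neg_le_of_measure_le {α : Type*} [MeasurableSpace α] {μ : Measure α}
    {w : α → ℝ} (hw : Measurable w) (hw0 : ∀ x, 0 ≤ w x)
    (hle : ∀ s, 0 ≤ s → μ {x | w x ≤ s} ≤ ENNReal.ofReal s) {m : ℝ} (hm : 0 < m)
    (hμ : μ univ = ENNReal.ofReal m) {k : ℝ} (hk0 : 0 < k) (hk1 : k < 1) :
    ∫⁻ x, ENNReal.ofReal (w x ^ (-k)) ∂μ ≤ ENNReal.ofReal (m ^ (1 - k) / (1 - k)) := by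
  have hm' : Measurable fun x => w x ^ (-k) := hw.pow_const _
  rw [lintegral_eq_lintegral_meas_lt μ
    (Filter.Eventually.of_forall fun x => Real.rpow_nonneg (hw0 x) _) hm'.aemeasurable]
  set L := m ^ (-k) with hL
  have hL0 : 0 < L := Real.rpow_pos_of_pos hm _
  have ha : -1 / k < -1 := by
    rw [div_lt_iff₀ hk0]
    linarith
  have hsplit : Ioi (0 : ℝ) = Ioc 0 L ∪ Ioi L := (Ioc_union_Ioi_eq_Ioi hL0.le).symm
  rw [hsplit]
  refine (lintegral_union_le _ _ _).trans ?_
  have h1 : ∫⁻ t in Ioc 0 L, μ {x | t < w x ^ (-k)} ≤ ENNReal.ofReal (m ^ (1 - k)) := by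
    calc _ ≤ ∫⁻ t in Ioc 0 L, ENNReal.ofReal m :=
          lintegral_mono fun t => (measure_mono (subset_univ _)).trans hμ.le
      _ = _ := by
          rw [setLIntegral_const, Real.volume_Ioc, _root_.sub_zero, ← ENNReal.ofReal_mul hm.le, hL,
            sub_eq_add_neg, Real.rpow_add hm, Real.rpow_one]
  have h2 : ∫⁻ t in Ioi L, μ {x | t < w x ^ (-k)} ≤
      ENNReal.ofReal (k / (1 - k) * m ^ (1 - k)) := by
    calc _ ≤ ∫⁻ t in Ioi L, ENNReal.ofReal (t ^ (-1 / k)) := by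
          refine setLIntegral_mono' measurableSet_Ioi fun t ht => ?_
          have ht0 : 0 < t := hL0.trans ht
          refine (measure_mono fun x (hx : t < w x ^ (-k)) => ?_).trans
            (hle _ (Real.rpow_nonneg ht0.le _))
          rcases (hw0 x).eq_or_lt with h0 | h0
          · rw [← h0, Real.zero_rpow (by linarith)] at hx
            exact absurd hx ht0.not_gt
          · have := Real.rpow_le_rpow_of_nonpos ht0 hx.le
              (div_nonpos_of_nonpos_of_nonneg (by norm_num : (-1 : ℝ) ≤ 0) hk0.le)
            rw [← Real.rpow_mul h0.le] at this
            rw [show -k * (-1 / k) = 1 by field_simp, Real.rpow_one] at this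
            exact this
      _ = _ := by
          rw [← ofReal_integral_eq_lintegral_ofReal (integrableOn_Ioi_rpow_of_lt ha hL0),
            integral_Ioi_rpow_of_lt ha hL0, hL, ← Real.rpow_mul hm.le]
          · congr 1
            rw [show -k * (-1 / k + 1) = 1 - k by field_simp; ring]
            have : (1 : ℝ) - k ≠ 0 := by linarith
            have h3 : -1 / k + 1 = -((1 - k) / k) := by
              field_simp
              ring
            rw [h3]
            field_simp
          · exact (ae_restrict_mem measurableSet_Ioi).mono fun t ht =>
              Real.rpow_nonneg (hL0.trans ht).le _
  refine (add_le_add h1 h2).trans_eq ?_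
  have hk1' : 0 < 1 - k := by linarith
  rw [← ENNReal.ofReal_add (by positivity) (by positivity)]
  congr 1
  field_simp
  ring

theorem lintegral_isoWeight_rpow_le {v : ℂ → ℝ} (hv : Continuous v) (hv1 : ∀ x, v x ≤ 1)
    {m : ℝ} (hm : 0 < m) (hvol : volume {x | v x < 1} = ENNReal.ofReal m) {q : ℝ} (hq0 : 0 < q)
    (hq2 : q < 2) :
    ∫⁻ x, isoWeight v (v x) ^ q ≤
      ENNReal.ofReal ((2 * √Real.pi) ^ (-q) * (m ^ (1 - q / 2) / (1 - q / 2))) := by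
  set A := {x | v x < 1} with hA
  have hAm : MeasurableSet A := (isOpen_lt hv continuous_const).measurableSet
  set V : ℝ → ℝ≥0∞ := fun t => volume {y | v y ≤ t} with hV
  have hVmono : Monotone V := fun s t hst => measure_mono fun x (hx : v x ≤ s) => hx.trans hst
  have hVfin : ∀ t, t < 1 → V t ≠ ⊤ := fun t ht => by
    refine ne_top_of_le_ne_top (hvol ▸ ENNReal.ofReal_ne_top) (b := volume A) ?_
    exact measure_mono fun x (hx : v x ≤ t) => hx.trans_lt ht
  have hpi : 0 < 2 * √Real.pi := by
    have := Real.pi_pos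
    positivity
  have hout : ∀ x ∉ A, isoWeight v (v x) ^ q = 0 := by
    intro x hx
    have hx1 : v x = 1 := le_antisymm (hv1 x) (not_lt.1 hx)
    have : {y | v y ≤ 1} = univ := eq_univ_of_forall hv1
    rw [isoWeight, hx1, this, discPerimeter, measure_univ_of_isAddLeftInvariant,
      ENNReal.top_rpow_of_pos (by norm_num), ENNReal.mul_top (by simpa using hpi), ENNReal.inv_top,
      ENNReal.zero_rpow_of_pos hq0]
  have hAint : ∫⁻ x, isoWeight v (v x) ^ q = ∫⁻ x in A, isoWeight v (v x) ^ q := by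
    rw [← lintegral_indicator hAm]
    refine lintegral_congr fun x => ?_
    by_cases hx : x ∈ A
    · rw [indicator_of_mem hx]
    · rw [indicator_of_notMem hx, hout x hx]
  rw [hAint]
  have hw : Measurable fun x => (V (v x)).toReal := (hVmono.measurable.comp hv.measurable).ennreal_toReal
  have hle : ∀ s, 0 ≤ s → (volume.restrict A) {x | (V (v x)).toReal ≤ s} ≤ ENNReal.ofReal s := by
    intro s hs
    rw [Measure.restrict_apply (measurableSet_le hw measurable_const)]
    refine (measure_mono ?_).trans (volume_setOf_volume_sublevel_le v _)
    rintro x ⟨hx, hxA⟩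
    exact (ENNReal.le_ofReal_iff_toReal_le (hVfin _ hxA) hs).2 hx
  have hk := lintegral_rpow_neg_le_of_measure_le hw (fun _ => ENNReal.toReal_nonneg) hle hm
    (by rw [Measure.restrict_apply_univ, hvol]) (half_pos hq0) (by linarith : q / 2 < 1)
  have hpos : ∀ᵐ x ∂(volume.restrict A), V (v x) ≠ 0 := by
    refine ae_restrict_of_ae ?_
    rw [ae_iff]
    have := volume_setOf_volume_sublevel_le v 0
    simpa [hV] using this
  rw [ENNReal.ofReal_mul (Real.rpow_nonneg hpi.le _)]
  calc _ = ∫⁻ x in A, ENNReal.ofReal ((2 * √Real.pi) ^ (-q)) *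
        ENNReal.ofReal ((V (v x)).toReal ^ (-(q / 2))) := by
        refine lintegral_congr_ae ?_
        filter_upwards [hpos, ae_restrict_mem hAm] with x hx hxA
        have hx0 : 0 < (V (v x)).toReal := ENNReal.toReal_pos hx (hVfin _ hxA)
        have hVx : volume {y | v y ≤ v x} = ENNReal.ofReal (V (v x)).toReal :=
          (ENNReal.ofReal_toReal (hVfin _ hxA)).symm
        rw [isoWeight, discPerimeter, hVx,
          ENNReal.ofReal_rpow_of_pos hx0, ← ENNReal.ofReal_mul hpi.le,
          ← ENNReal.ofReal_inv_of_pos (by positivity), ENNReal.ofReal_rpow_of_pos (by positivity),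
          ← ENNReal.ofReal_mul (by positivity), Real.inv_rpow (by positivity),
          Real.mul_rpow hpi.le (by positivity), ← Real.rpow_mul hx0.le, mul_inv,
          Real.rpow_neg hpi.le, Real.rpow_neg hx0.le, one_div_mul_eq_div]
    _ = ENNReal.ofReal ((2 * √Real.pi) ^ (-q)) *
        ∫⁻ x in A, ENNReal.ofReal ((V (v x)).toReal ^ (-(q / 2))) :=
        lintegral_const_mul _ (hw.pow_const _).ennreal_ofReal
    _ ≤ _ := by gcongr

/-- The path pseudo-distance from `c` to `x` with respect to the density `κ`, computed with
`1`-Lipschitz paths. -/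
def pathDist (κ : ℂ → ℝ) (c x : ℂ) : ℝ≥0∞ :=
  ⨅ (η : ℝ → ℂ) (T : ℝ) (_ : LipschitzWith 1 η ∧ 0 ≤ T ∧ η 0 = c ∧ η T = x),
    ∫⁻ t in Icc 0 T, ENNReal.ofReal (κ (η t))

theorem pathDist_self (κ : ℂ → ℝ) (c : ℂ) : pathDist κ c c = 0 := by
  refine le_antisymm ?_ zero_le
  refine (iInf_le _ fun _ => c).trans ((iInf_le _ 0).trans
    ((iInf_le _ ⟨LipschitzWith.const' c, le_rfl, rfl, rfl⟩).trans ?_))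
  simp

theorem lipschitzWith_glue_segment {η : ℝ → ℂ} (hη : LipschitzWith 1 η) (T : ℝ) {e : ℂ}
    (he : ‖e‖ ≤ 1) : LipschitzWith 1 fun t => η (min t T) + ((max t T - T : ℝ) : ℂ) * e := by
  refine LipschitzWith.of_dist_le_mul fun s t => ?_
  rw [NNReal.coe_one, one_mul, dist_eq_norm]
  have h1 := hη.dist_le_mul (min s T) (min t T)
  rw [NNReal.coe_one, one_mul, dist_eq_norm, Real.dist_eq] at h1
  have h2 : ‖((max s T - T : ℝ) : ℂ) * e - ((max t T - T : ℝ) : ℂ) * e‖ ≤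
      |max s T - max t T| := by
    rw [← sub_mul, ← Complex.ofReal_sub, norm_mul, Complex.norm_real, Real.norm_eq_abs]
    rw [_root_.sub_sub_sub_cancel_right]
    exact mul_le_of_le_one_right (abs_nonneg _) he
  have h3 : |min s T - min t T| + |max s T - max t T| = dist s t := by
    rw [Real.dist_eq]
    rcases le_total s t with hst | hst
    · rw [abs_of_nonpos (sub_nonpos.2 (min_le_min_right T hst)),
        abs_of_nonpos (sub_nonpos.2 (max_le_max_right T hst)), abs_of_nonpos (sub_nonpos.2 hst)]
      linarith [min_add_max s T, min_add_max t T]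
    · rw [abs_of_nonneg (sub_nonneg.2 (min_le_min_right T hst)),
        abs_of_nonneg (sub_nonneg.2 (max_le_max_right T hst)), abs_of_nonneg (sub_nonneg.2 hst)]
      linarith [min_add_max s T, min_add_max t T]
  calc _ = ‖(η (min s T) - η (min t T)) +
        (((max s T - T : ℝ) : ℂ) * e - ((max t T - T : ℝ) : ℂ) * e)‖ := by
        congr 1
        ring
    _ ≤ _ := (norm_add_le _ _).trans (by linarith)

theorem pathDist_le_add {κ : ℂ → ℝ} {Λ : ℝ}
    (hκ : ∀ x y, κ y ≤ κ x + Λ * dist y x) (hΛ : 0 ≤ Λ) (c x y : ℂ) :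
    pathDist κ c x ≤ pathDist κ c y + ENNReal.ofReal (dist y x * (κ x + Λ * dist y x)) := by
  set d := dist y x with hd
  rcases (dist_nonneg (x := y) (y := x)).eq_or_lt with h0 | hd0
  · rw [eq_comm, dist_eq_zero] at h0
    rw [h0]
    exact le_self_add
  rw [← hd] at hd0
  unfold pathDist
  simp_rw [ENNReal.iInf_add]
  refine le_iInf fun η => le_iInf fun T => le_iInf fun h => ?_
  obtain ⟨hη, hT, hη0, hηT⟩ := h
  set e : ℂ := (x - y) / (d : ℂ) with he
  have hdC : (d : ℂ) ≠ 0 := by exact_mod_cast hd0.ne'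
  have hde : (d : ℂ) * e = x - y := by
    rw [he]
    field_simp
  have hnorm : ‖x - y‖ = d := by rw [hd, dist_eq_norm, norm_sub_rev]
  have hen : ‖e‖ ≤ 1 := by
    rw [he, norm_div, hnorm, Complex.norm_real, Real.norm_eq_abs, abs_of_pos hd0,
      div_self hd0.ne']
  set η' : ℝ → ℂ := fun t => η (min t T) + ((max t T - T : ℝ) : ℂ) * e with hη'
  have hle : ∀ t ≤ T, η' t = η t := fun t ht => by
    simp [hη', min_eq_left ht, max_eq_right ht]
  have hge : ∀ t, T ≤ t → η' t = y + ((t - T : ℝ) : ℂ) * e := fun t ht => by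
    simp only [hη', min_eq_right ht, max_eq_left ht, hηT]
  have hend : η' (T + d) = x := by
    rw [hge _ (by linarith), add_sub_cancel_left, hde]
    ring
  refine (iInf_le _ η').trans ((iInf_le _ (T + d)).trans ((iInf_le _ ⟨
    lipschitzWith_glue_segment hη T hen, by linarith, by rw [hle 0 hT, hη0], hend⟩).trans ?_))
  rw [← Icc_union_Ioc_eq_Icc hT (by linarith : T ≤ T + d)]
  refine (lintegral_union_le _ _ _).trans (add_le_add (le_of_eq ?_) ?_)
  · exact setLIntegral_congr_fun measurableSet_Icc fun t ht => by
      simp only [hle t ht.2]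
  · calc _ ≤ ∫⁻ t in Ioc T (T + d), ENNReal.ofReal (κ x + Λ * d) := by
          refine setLIntegral_mono' measurableSet_Ioc fun t ht => ENNReal.ofReal_le_ofReal ?_
          refine (hκ x _).trans ?_
          gcongr
          rw [hge t ht.1.le, dist_eq_norm]
          have : y + ((t - T : ℝ) : ℂ) * e - x = ((t - T - d : ℝ) : ℂ) * e := by
            push_cast
            linear_combination hde
          rw [this, norm_mul, Complex.norm_real, Real.norm_eq_abs]
          refine (mul_le_of_le_one_right (abs_nonneg _) hen).trans ?_
          rw [abs_le]
          constructor <;> linarith [ht.1, ht.2]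
      _ = _ := by
          rw [setLIntegral_const, Real.volume_Ioc, add_sub_cancel_left, mul_comm,
            ENNReal.ofReal_mul hd0.le]

/-- The value `∫₀^m (2 √(π s))^{-q} ds`. -/
def isoConst (q m : ℝ) : ℝ := (2 * √Real.pi) ^ (-q) * (m ^ (1 - q / 2) / (1 - q / 2))

/-- Extremal weight for the capacity of a condenser whose outer set is `A` and whose density has
been regularized. -/
theorem exists_weight {κ : ℂ → ℝ} {Λ M : ℝ} (hκc : Continuous κ) (hκ0 : ∀ x, 0 ≤ κ x)
    (hκM : ∀ x, κ x ≤ M) (hκ : ∀ x y, κ y ≤ κ x + Λ * dist y x) (hΛ : 0 ≤ Λ) {c : ℂ} {A : Set ℂ}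
    (hA : Bornology.IsBounded A)
    (hadm : ∀ (η : ℝ → ℂ) (T : ℝ), LipschitzWith 1 η → 0 ≤ T → η 0 = c → η T ∉ A →
      1 ≤ ∫⁻ t in Icc 0 T, ENNReal.ofReal (κ (η t))) {q : ℝ} (hq0 : 0 < q) (hq2 : q < 2) :
    ∃ w : ℂ → ℝ≥0∞, Measurable w ∧ 1 ≤ ∫⁻ x, ENNReal.ofReal (κ x) * w x ∧
      ∫⁻ x, w x ^ q ≤ ENNReal.ofReal (isoConst q (volume A).toReal) := by
  set v : ℂ → ℝ := fun x => (min (pathDist κ c x) 1).toReal with hvdef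
  have hM0 : 0 ≤ M := (hκ0 0).trans (hκM 0)
  have fin : ∀ x, min (pathDist κ c x) 1 ≠ ⊤ := fun x =>
    ne_top_of_le_ne_top ENNReal.one_ne_top (min_le_right _ _)
  have hv1 : ∀ x, v x ≤ 1 := fun x => by
    have := ENNReal.toReal_mono ENNReal.one_ne_top (min_le_right (pathDist κ c x) 1)
    simpa using this
  have hvc : v c = 0 := by simp [hvdef, pathDist_self]
  have hlip : ∀ x y, v x ≤ v y + dist y x * (κ x + Λ * dist y x) := by
    intro x y
    have hnn : 0 ≤ dist y x * (κ x + Λ * dist y x) := by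
      have := hκ0 x
      positivity
    have h1 : min (pathDist κ c x) 1 ≤
        min (pathDist κ c y) 1 + ENNReal.ofReal (dist y x * (κ x + Λ * dist y x)) := by
      rw [← min_add_add_right]
      exact min_le_min (pathDist_le_add hκ hΛ c x y) le_self_add
    have h2 := ENNReal.toReal_mono (ENNReal.add_ne_top.2 ⟨fin y, ENNReal.ofReal_ne_top⟩) h1
    rwa [ENNReal.toReal_add (fin y) ENNReal.ofReal_ne_top, ENNReal.toReal_ofReal hnn] at h2
  have hvcont : Continuous v := by
    refine continuous_iff_continuousAt.2 fun x => ?_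
    have hb : Filter.Tendsto (fun y => dist y x * (M + Λ * dist y x)) (nhds x) (nhds 0) := by
      have : Continuous fun y => dist y x * (M + Λ * dist y x) := by fun_prop
      simpa using this.tendsto x
    refine tendsto_iff_dist_tendsto_zero.2
      (squeeze_zero (fun _ => dist_nonneg) (fun y => ?_) hb)
    have h1 := hlip x y
    have h2 := hlip y x
    rw [dist_comm x y] at h2
    have h3 : dist y x * (κ x + Λ * dist y x) ≤ dist y x * (M + Λ * dist y x) := by
      gcongr
      exact hκM x
    have h4 : dist y x * (κ y + Λ * dist y x) ≤ dist y x * (M + Λ * dist y x) := by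
      gcongr
      exact hκM y
    rw [Real.dist_eq, abs_le]
    constructor <;> linarith
  have hsub : {x | v x < 1} ⊆ A := by
    intro x (hx : v x < 1)
    by_contra hxA
    have h1 : 1 ≤ pathDist κ c x := by
      refine le_iInf fun η => le_iInf fun T => le_iInf fun h => ?_
      exact hadm η T h.1 h.2.1 h.2.2.1 (by rwa [h.2.2.2])
    simp [hvdef, min_eq_right h1] at hx
  have hbdd := hA.subset hsub
  have hpos : volume {x | v x < 1} ≠ 0 :=
    ((isOpen_lt hvcont continuous_const).measure_pos volume
      ⟨c, show v c < 1 by rw [hvc]; norm_num⟩).ne'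
  have hfin := hbdd.measure_lt_top (μ := volume).ne
  set m := (volume {x | v x < 1}).toReal with hm
  have hm0 : 0 < m := ENNReal.toReal_pos hpos hfin
  have hmA : m ≤ (volume A).toReal :=
    ENNReal.toReal_mono hA.measure_lt_top.ne (measure_mono hsub)
  have hvol : volume {x | v x < 1} = ENNReal.ofReal m := (ENNReal.ofReal_toReal hfin).symm
  refine ⟨fun x => isoWeight v (v x), (isoWeight_antitone v).measurable.comp hvcont.measurable,
    ?_, ?_⟩
  · refine one_le_lintegral_mul_isoWeight hvcont hbdd hvc.le hκc hκ0 hκM hΛ hlip ?_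
    have := lintegral_isoWeight_rpow_le hvcont hv1 hm0 hvol one_pos (by norm_num : (1 : ℝ) < 2)
    simp only [ENNReal.rpow_one] at this
    exact ne_top_of_le_ne_top ENNReal.ofReal_ne_top this
  · refine (lintegral_isoWeight_rpow_le hvcont hv1 hm0 hvol hq0 hq2).trans ?_
    apply ENNReal.ofReal_le_ofReal
    have : 0 < 1 - q / 2 := by linarith
    unfold isoConst
    gcongr

/-- The unnormalized tent function of radius `δ`. -/
def tent (δ : ℝ) (h : ℂ) : ℝ := max 0 (δ - ‖h‖)

theorem continuous_tent (δ : ℝ) : Continuous (tent δ) := by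
  unfold tent
  fun_prop

theorem tent_nonneg (δ : ℝ) (h : ℂ) : 0 ≤ tent δ h := le_max_left _ _

theorem tent_le {δ : ℝ} (hδ : 0 ≤ δ) (h : ℂ) : tent δ h ≤ δ :=
  max_le hδ (by linarith [norm_nonneg h])

theorem tent_le_add (δ : ℝ) (h k : ℂ) : tent δ h ≤ tent δ k + ‖h - k‖ := by
  unfold tent
  refine max_le (by positivity) ?_
  have h1 : δ - ‖k‖ ≤ max 0 (δ - ‖k‖) := le_max_right _ _
  have h2 : ‖k‖ ≤ ‖h‖ + ‖h - k‖ := by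
    have := norm_sub_norm_le k h
    rw [norm_sub_rev] at this
    linarith
  linarith

theorem tent_eq_zero {δ : ℝ} {h : ℂ} (hh : δ ≤ ‖h‖) : tent δ h = 0 :=
  max_eq_left (by linarith)

theorem lintegral_tent_ne_zero {δ : ℝ} (hδ : 0 < δ) : ∫⁻ h, ENNReal.ofReal (tent δ h) ≠ 0 := by
  rw [Ne, lintegral_eq_zero_iff (continuous_tent δ).measurable.ennreal_ofReal]
  intro h
  have hc := (h.mono fun x hx => (show x ∉ ball (0 : ℂ) δ from fun hxb => by
    have h1 : tent δ x = δ - ‖x‖ := max_eq_right (by linarith [mem_ball_zero_iff.1 hxb])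
    have h2 : tent δ x ≤ 0 := ENNReal.ofReal_eq_zero.1 hx
    linarith [mem_ball_zero_iff.1 hxb]))
  have h0 : volume (ball (0 : ℂ) δ) = 0 := by
    rw [ae_iff] at hc
    convert hc using 2
    ext x
    simp
  exact (measure_ball_pos volume (0 : ℂ) hδ).ne' h0

theorem lintegral_tent_ne_top {δ : ℝ} (hδ : 0 < δ) : ∫⁻ h, ENNReal.ofReal (tent δ h) ≠ ⊤ := by
  refine ne_top_of_le_ne_top (b := ∫⁻ h in ball (0 : ℂ) δ, ENNReal.ofReal δ) ?_ ?_
  · rw [setLIntegral_const]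
    exact ENNReal.mul_ne_top ENNReal.ofReal_ne_top isBounded_ball.measure_lt_top.ne
  · rw [← lintegral_indicator measurableSet_ball]
    refine lintegral_mono fun h => ?_
    by_cases hh : h ∈ ball (0 : ℂ) δ
    · rw [indicator_of_mem hh]
      exact ENNReal.ofReal_le_ofReal (tent_le hδ.le h)
    · rw [tent_eq_zero (by simpa using hh)]
      simp

/-- Capacity estimate for a density that is admissible for all small translates of the curves
joining `c` to the complement of `A`. -/
theorem one_le_rpow_mul_isoConst {ρ : ℂ → ℝ≥0∞} (hρ : Measurable ρ) (hρfin : ∫⁻ x, ρ x ≠ ⊤)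
    {δ : ℝ} (hδ : 0 < δ) {c : ℂ} {A : Set ℂ} (hA : Bornology.IsBounded A)
    (hadm : ∀ (η : ℝ → ℂ) (T : ℝ), LipschitzWith 1 η → 0 ≤ T → η 0 = c → η T ∉ A →
      ∀ h, ‖h‖ < δ → 1 ≤ ∫⁻ t in Icc 0 T, ρ (η t + h)) {p q : ℝ} (hpq : p.HolderConjugate q)
    (hq2 : q < 2) :
    1 ≤ (∫⁻ x, ρ x ^ p) ^ (1 / p) * ENNReal.ofReal (isoConst q (volume A).toReal) ^ (1 / q) := by
  set C : ℝ≥0∞ := ∫⁻ h, ENNReal.ofReal (tent δ h) with hC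
  have hC0 : C ≠ 0 := lintegral_tent_ne_zero hδ
  have hCt : C ≠ ⊤ := lintegral_tent_ne_top hδ
  set k : ℂ → ℝ≥0∞ := fun h => C⁻¹ * ENNReal.ofReal (tent δ h) with hk
  have hkm : Measurable k := (continuous_tent δ).measurable.ennreal_ofReal.const_mul _
  have hk1 : ∫⁻ h, k h = 1 := by
    rw [lintegral_const_mul _ (continuous_tent δ).measurable.ennreal_ofReal, ← hC,
      ENNReal.inv_mul_cancel hC0 hCt]
  have hk0 : ∀ h, δ ≤ ‖h‖ → k h = 0 := fun h hh => by simp [hk, tent_eq_zero hh]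
  set K : ℂ → ℝ≥0∞ := fun x => ∫⁻ y, k (y - x) * ρ y with hK
  have hKshift : ∀ x, K x = ∫⁻ h, k h * ρ (x + h) := fun x => by
    simp only [hK]
    rw [← lintegral_add_left_eq_self (fun y => k (y - x) * ρ y) x]
    simp
  have hKle : ∀ x, K x ≤ C⁻¹ * ENNReal.ofReal δ * ∫⁻ y, ρ y := fun x => by
    rw [← lintegral_const_mul _ hρ]
    refine lintegral_mono fun y => ?_
    simp only [hk]
    gcongr
    exact tent_le hδ.le _
  have hMt : C⁻¹ * ENNReal.ofReal δ * ∫⁻ y, ρ y ≠ ⊤ :=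
    ENNReal.mul_ne_top (ENNReal.mul_ne_top (ENNReal.inv_ne_top.2 hC0) ENNReal.ofReal_ne_top) hρfin
  have hKt : ∀ x, K x ≠ ⊤ := fun x => ne_top_of_le_ne_top hMt (hKle x)
  have hLt : C⁻¹ * ∫⁻ y, ρ y ≠ ⊤ := ENNReal.mul_ne_top (ENNReal.inv_ne_top.2 hC0) hρfin
  have hKadd : ∀ x y, K y ≤ K x + (C⁻¹ * ∫⁻ y, ρ y) * ENNReal.ofReal (dist y x) := fun x y => by
    have h1 : (C⁻¹ * ∫⁻ y, ρ y) * ENNReal.ofReal (dist y x) =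
        ∫⁻ z, C⁻¹ * ENNReal.ofReal (dist y x) * ρ z := by
      rw [lintegral_const_mul _ hρ]
      ring
    rw [h1, hK, ← lintegral_add_right _ (hρ.const_mul _)]
    refine lintegral_mono fun z => ?_
    simp only [hk]
    rw [← add_mul, ← mul_add]
    gcongr
    rw [← ENNReal.ofReal_add (tent_nonneg _ _) dist_nonneg]
    apply ENNReal.ofReal_le_ofReal
    refine (tent_le_add δ (z - y) (z - x)).trans (le_of_eq ?_)
    rw [dist_eq_norm, norm_sub_rev y x]
    congr 2
    ring
  set κ : ℂ → ℝ := fun x => (K x).toReal with hκdef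
  have hκof : ∀ x, ENNReal.ofReal (κ x) = K x := fun x => ENNReal.ofReal_toReal (hKt x)
  set Λ : ℝ := (C⁻¹ * ∫⁻ y, ρ y).toReal with hΛ
  have hκ : ∀ x y, κ y ≤ κ x + Λ * dist y x := fun x y => by
    have h1 := ENNReal.toReal_mono (ENNReal.add_ne_top.2
      ⟨hKt x, ENNReal.mul_ne_top hLt ENNReal.ofReal_ne_top⟩) (hKadd x y)
    rwa [ENNReal.toReal_add (hKt x) (ENNReal.mul_ne_top hLt ENNReal.ofReal_ne_top),
      ENNReal.toReal_mul, ENNReal.toReal_ofReal dist_nonneg] at h1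
  have hΛ0 : 0 ≤ Λ := ENNReal.toReal_nonneg
  have hκc : Continuous κ := by
    refine (LipschitzWith.of_dist_le_mul (K := Λ.toNNReal) fun x y => ?_).continuous
    rw [Real.coe_toNNReal _ hΛ0, Real.dist_eq, abs_le]
    have h1 := hκ x y
    have h2 := hκ y x
    rw [dist_comm y x] at h1
    constructor <;> linarith
  have hκadm : ∀ (η : ℝ → ℂ) (T : ℝ), LipschitzWith 1 η → 0 ≤ T → η 0 = c → η T ∉ A →
      1 ≤ ∫⁻ t in Icc 0 T, ENNReal.ofReal (κ (η t)) := by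
    intro η T hη hT h0 hTA
    simp_rw [hκof, hKshift]
    rw [lintegral_lintegral_swap (by
      have := hη.continuous.measurable
      exact Measurable.aemeasurable (by
        change Measurable fun z : ℝ × ℂ => k z.2 * ρ (η z.1 + z.2)
        fun_prop))]
    calc (1 : ℝ≥0∞) = ∫⁻ h, k h := hk1.symm
      _ ≤ _ := lintegral_mono fun h => by
        have hm : Measurable fun t => ρ (η t + h) := by
          have := hη.continuous.measurable
          fun_prop
        rw [lintegral_const_mul _ hm]
        rcases lt_or_ge ‖h‖ δ with hh | hh
        · exact le_mul_of_one_le_right' (hadm η T hη hT h0 hTA h hh)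
        · simp [hk0 h hh]
  obtain ⟨w, hwm, hw1, hwq⟩ := exists_weight (M := (C⁻¹ * ENNReal.ofReal δ * ∫⁻ y, ρ y).toReal)
    hκc (fun x => ENNReal.toReal_nonneg) (fun x => ENNReal.toReal_mono hMt (hKle x)) hκ hΛ0 hA
    hκadm hpq.symm.pos hq2
  refine hw1.trans ?_
  have hinner : ∀ h, ∫⁻ x, ρ (x + h) * w x ≤
      (∫⁻ x, ρ x ^ p) ^ (1 / p) * (∫⁻ x, w x ^ q) ^ (1 / q) := fun h => by
    have hm : Measurable fun x => ρ (x + h) := by fun_prop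
    refine (ENNReal.lintegral_mul_le_Lp_mul_Lq volume hpq hm.aemeasurable hwm.aemeasurable).trans
      (le_of_eq ?_)
    rw [lintegral_add_right_eq_self (fun x => ρ x ^ p) h]
  calc ∫⁻ x, ENNReal.ofReal (κ x) * w x = ∫⁻ x, ∫⁻ h, k h * ρ (x + h) * w x := by
        refine lintegral_congr fun x => ?_
        have hm : Measurable fun h => k h * ρ (x + h) := by fun_prop
        rw [hκof, hKshift, lintegral_mul_const _ hm]
    _ = ∫⁻ h, ∫⁻ x, k h * ρ (x + h) * w x := by
        refine lintegral_lintegral_swap (Measurable.aemeasurable ?_)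
        change Measurable fun z : ℂ × ℂ => k z.2 * ρ (z.1 + z.2) * w z.1
        fun_prop
    _ ≤ ∫⁻ h, k h * ((∫⁻ x, ρ x ^ p) ^ (1 / p) * (∫⁻ x, w x ^ q) ^ (1 / q)) := by
        refine lintegral_mono fun h => ?_
        simp_rw [mul_assoc]
        have hm : Measurable fun x => ρ (x + h) * w x := by fun_prop
        rw [lintegral_const_mul _ hm]
        gcongr
        exact hinner h
    _ = (∫⁻ x, ρ x ^ p) ^ (1 / p) * (∫⁻ x, w x ^ q) ^ (1 / q) := by
        rw [lintegral_mul_const _ hkm, hk1, one_mul]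
    _ ≤ _ := by
        gcongr
        exact hpq.symm.one_div_nonneg

theorem lineIntegral_comp_clamp_le (ρ : ℂ → ℝ≥0∞) {η : ℝ → ℂ} (hη : LipschitzWith 1 η) {T : ℝ}
    (hT : 0 ≤ T) :
    lineIntegral ρ (fun t => η (T * max 0 (min t 1))) ≤ ∫⁻ t in Icc 0 T, ρ (η t) := by
  have hlip : LipschitzWith T.toNNReal fun t => η (T * max 0 (min t 1)) := by
    refine LipschitzWith.of_dist_le_mul fun s t => (hη.dist_le_mul _ _).trans ?_
    rw [NNReal.coe_one, one_mul, Real.coe_toNNReal _ hT, Real.dist_eq, ← mul_sub, abs_mul,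
      abs_of_nonneg hT]
    refine mul_le_mul_of_nonneg_left ?_ hT
    have hc : LipschitzWith 1 fun t : ℝ => max 0 (min t 1) :=
      (LipschitzWith.id.min_const 1).const_max 0
    simpa [Real.dist_eq] using hc.dist_le_mul s t
  rw [lineIntegral, if_pos ⟨_, hlip.lipschitzOnWith⟩]
  have hder : ∀ t, (‖deriv (fun t => η (T * max 0 (min t 1))) t‖₊ : ℝ≥0∞) ≤ ENNReal.ofReal T :=
    fun t => by
      have := norm_deriv_le_of_lipschitz (x₀ := t) hlip
      exact ENNReal.coe_le_coe.2 this
  rcases hT.eq_or_lt with h0 | hT0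
  · refine le_of_eq_of_le ?_ zero_le
    refine (lintegral_congr fun t => ?_).trans lintegral_zero
    have := hder t
    rw [← h0, ENNReal.ofReal_zero, nonpos_iff_eq_zero] at this
    rw [← h0, this, mul_zero]
  have himg : (fun t : ℝ => T * t) '' Icc 0 1 = Icc 0 T := by
    rw [image_mul_left_Icc hT zero_le_one, mul_zero, mul_one]
  rw [← himg, lintegral_image_eq_lintegral_abs_deriv_mul measurableSet_Icc (f' := fun _ => T)
    (fun t _ => by simpa using ((hasDerivAt_id t).const_mul T).hasDerivWithinAt)
    (fun a _ b _ h => mul_left_cancel₀ hT0.ne' h)]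
  refine setLIntegral_mono' measurableSet_Icc fun t ht => ?_
  rw [min_eq_left ht.2, max_eq_right ht.1, mul_comm, abs_of_pos hT0]
  gcongr
  exact hder t

theorem exists_first_exit {X : Type*} [TopologicalSpace X] {η : ℝ → X} (hη : Continuous η)
    {U : Set X} (hU : IsOpen U) {T : ℝ} (hT : 0 ≤ T) (hTU : η T ∉ U) :
    ∃ s ∈ Icc 0 T, η s ∉ U ∧ ∀ t ∈ Ico 0 s, η t ∈ U := by
  have hc : IsCompact (Icc 0 T ∩ η ⁻¹' Uᶜ) :=
    isCompact_Icc.inter_right (hU.isClosed_compl.preimage hη)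
  obtain ⟨s, ⟨hs, hsU⟩, hleast⟩ := hc.exists_isLeast ⟨T, ⟨hT, le_rfl⟩, hTU⟩
  refine ⟨s, hs, hsU, fun t ht => ?_⟩
  by_contra htU
  exact absurd (hleast ⟨⟨ht.1, ht.2.le.trans hs.2⟩, htU⟩) (not_le.2 ht.2)

theorem IsHomeoOn.continuousOn_invFunOn {f : ℂ → ℂ} {D : Set ℂ} (hf : IsHomeoOn f D)
    (hD : IsOpen D) : ContinuousOn (Function.invFunOn f D) (f '' D) := by
  obtain ⟨-, hinj, hopen⟩ := hf
  rw [continuousOn_open_iff (hopen D Subset.rfl hD)]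
  intro t ht
  convert hopen (D ∩ t) inter_subset_left (hD.inter ht) using 1
  ext y
  constructor
  · rintro ⟨⟨x, hx, rfl⟩, hy⟩
    rw [mem_preimage, hinj.leftInvOn_invFunOn hx] at hy
    exact ⟨x, ⟨hx, hy⟩, rfl⟩
  · rintro ⟨x, ⟨hx, hxt⟩, rfl⟩
    refine ⟨⟨x, hx, rfl⟩, ?_⟩
    rwa [mem_preimage, hinj.leftInvOn_invFunOn hx]

/-- The curves in the disc of radius `r₂` about `z₀` that join the disc of radius `r₁` to the
circle of radius `r₂`. -/
def ringCurves (z₀ : ℂ) (r₁ r₂ : ℝ) : Set (ℝ → ℂ) :=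
  {γ | ContinuousOn γ (Icc 0 1) ∧ (∀ t ∈ Icc (0 : ℝ) 1, γ t ∈ closedBall z₀ r₂) ∧
    γ 0 ∈ closedBall z₀ r₁ ∧ r₂ ≤ dist (γ 1) z₀}

theorem IsHomeoOn.one_le_lintegral_indicator {f : ℂ → ℂ} {D : Set ℂ} (hf : IsHomeoOn f D)
    (hD : IsOpen D) {z₀ : ℂ} {r₁ r₂ : ℝ} (hr : r₁ < r₂) (hball : closedBall z₀ r₂ ⊆ D)
    {ρ : ℂ → ℝ≥0∞} (hρ : IsAdmissible ρ ((fun γ => f ∘ γ) '' ringCurves z₀ r₁ r₂))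
    {η : ℝ → ℂ} (hη : LipschitzWith 1 η) {T : ℝ} (hT : 0 ≤ T)
    (h0 : η 0 ∈ f '' closedBall z₀ r₁) (hTb : η T ∉ f '' ball z₀ r₂) :
    1 ≤ ∫⁻ t in Icc 0 T, (f '' closedBall z₀ r₂).indicator ρ (η t) := by
  set K := f '' closedBall z₀ r₂ with hK
  have hKc : IsClosed K :=
    ((isCompact_closedBall z₀ r₂).image_of_continuousOn (hf.1.mono hball)).isClosed
  have hbD : ball z₀ r₂ ⊆ D := ball_subset_closedBall.trans hball
  obtain ⟨s, hs, hsU, hsin⟩ :=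
    exists_first_exit hη.continuous (hf.2.2 _ hbD isOpen_ball) hT hTb
  have hs0 : 0 < s := by
    refine hs.1.lt_of_ne fun h => hsU ?_
    rw [← h]
    exact image_mono (closedBall_subset_ball hr) h0
  have hsK : ∀ t ∈ Icc 0 s, η t ∈ K := by
    have h1 : MapsTo η (Ico 0 s) K := fun t ht => image_mono ball_subset_closedBall (hsin t ht)
    have h2 := h1.closure hη.continuous
    rwa [closure_Ico hs0.ne, hKc.closure_eq] at h2
  set η' : ℝ → ℂ := fun t => η (s * max 0 (min t 1)) with hη'
  have hη'c : Continuous η' := hη.continuous.comp (by fun_prop)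
  have hη'K : ∀ t, η' t ∈ K := fun t => hsK _
    ⟨mul_nonneg hs0.le (le_max_left _ _),
      mul_le_of_le_one_right hs0.le (max_le zero_le_one (min_le_right _ _))⟩
  set g := Function.invFunOn f D with hg
  have hgf : ∀ x ∈ D, g (f x) = x := fun x hx => hf.2.1.leftInvOn_invFunOn hx
  have hgK : ∀ y ∈ K, g y ∈ closedBall z₀ r₂ ∧ f (g y) = y := by
    rintro _ ⟨x, hx, rfl⟩
    rw [hgf x (hball hx)]
    exact ⟨hx, rfl⟩
  have hcomp : f ∘ (g ∘ η') = η' := funext fun t => (hgK _ (hη'K t)).2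
  have hmem : g ∘ η' ∈ ringCurves z₀ r₁ r₂ := by
    refine ⟨?_, fun t _ => (hgK _ (hη'K t)).1, ?_, ?_⟩
    · exact ((hf.continuousOn_invFunOn hD).comp hη'c.continuousOn
        fun t _ => image_mono hball (hη'K t))
    · obtain ⟨x, hx, hx0⟩ := h0
      have : η' 0 = f x := by simp [hη', hx0]
      rw [Function.comp_apply, this, hgf x (hball (closedBall_subset_closedBall hr.le hx))]
      exact hx
    · by_contra hlt
      push Not at hlt
      refine hsU ⟨g (η' 1), hlt, ?_⟩
      rw [(hgK _ (hη'K 1)).2]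
      simp [hη']
  have h1 := hρ.2 _ ⟨g ∘ η', hmem, rfl⟩
  simp only [hcomp] at h1
  calc 1 ≤ ∫⁻ t in Icc 0 s, ρ (η t) := h1.trans (lineIntegral_comp_clamp_le ρ hη hs0.le)
    _ = ∫⁻ t in Icc 0 s, K.indicator ρ (η t) :=
        setLIntegral_congr_fun measurableSet_Icc fun t ht => by
          simp only [indicator_of_mem (hsK t ht)]
    _ ≤ _ := lintegral_mono_set (Icc_subset_Icc_right hs.2)

theorem isoConst_pos {q m : ℝ} (hq2 : q < 2) (hm : 0 < m) : 0 < isoConst q m := by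
  have : 0 < 1 - q / 2 := by linarith
  have := Real.pi_pos
  unfold isoConst
  positivity

/-- Lower bound for the modulus of the image of the curves of a ring in terms of the area of the
image of a larger disc. -/
theorem IsHomeoOn.inv_isoConst_rpow_le_pModulus {f : ℂ → ℂ} {D : Set ℂ} (hf : IsHomeoOn f D)
    (hD : IsOpen D) (hD' : Bornology.IsBounded (f '' D)) {z₀ : ℂ} {r₁ r₂ r : ℝ} (hr₁ : 0 < r₁)
    (hr₂ : r₁ < r₂) (hr : r₂ < r) (hball : closedBall z₀ r ⊆ D) {p q : ℝ}
    (hpq : p.HolderConjugate q) (hq2 : q < 2) :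
    (ENNReal.ofReal (isoConst q (volume (f '' ball z₀ r)).toReal) ^ (p - 1))⁻¹ ≤
      pModulus p ((fun γ => f ∘ γ) '' ringCurves z₀ r₁ r₂) := by
  set A := f '' ball z₀ r with hAdef
  have hrD : ball z₀ r ⊆ D := ball_subset_closedBall.trans hball
  have hr2D : closedBall z₀ r₂ ⊆ D := (closedBall_subset_ball hr).trans hrD
  have hr1D : ball z₀ r₁ ⊆ D :=
    (ball_subset_closedBall.trans (closedBall_subset_closedBall hr₂.le)).trans hr2D
  have hAo : IsOpen A := hf.2.2 _ hrD isOpen_ball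
  have hAb : Bornology.IsBounded A := hD'.subset (image_mono hrD)
  set N := ENNReal.ofReal (isoConst q (volume A).toReal) with hN
  have hp1 : 0 < p - 1 := hpq.sub_one_pos
  set K := f '' closedBall z₀ r₂ with hK
  have hKc : IsCompact K :=
    (isCompact_closedBall z₀ r₂).image_of_continuousOn (hf.1.mono hr2D)
  refine le_iInf fun ρ => le_iInf fun hρ => ?_
  rcases eq_or_ne (∫⁻ z, ρ z ^ p) ⊤ with htop | hfin
  · rw [htop]
    exact le_top
  obtain ⟨δ₁, hδ₁, hδ₁s⟩ := Metric.isOpen_iff.1 (hf.2.2 _ hr1D isOpen_ball) (f z₀)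
    ⟨z₀, mem_ball_self hr₁, rfl⟩
  obtain ⟨δ₂, hδ₂, hδ₂s⟩ := hKc.exists_thickening_subset_open hAo
    (image_mono (closedBall_subset_ball hr))
  have hadm : ∀ (η : ℝ → ℂ) (T : ℝ), LipschitzWith 1 η → 0 ≤ T → η 0 = f z₀ → η T ∉ A →
      ∀ h, ‖h‖ < min δ₁ δ₂ → 1 ≤ ∫⁻ t in Icc 0 T, K.indicator ρ (η t + h) := by
    intro η T hη hT h0 hTA h hh
    have hη' : LipschitzWith 1 fun t => η t + h :=
      LipschitzWith.of_dist_le_mul fun s t => by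
        rw [dist_add_right]
        exact hη.dist_le_mul s t
    refine hf.one_le_lintegral_indicator hD hr₂ hr2D hρ hη' hT ?_ ?_
    · refine image_mono ball_subset_closedBall (hδ₁s ?_)
      rw [mem_ball, h0, dist_eq_norm, add_sub_cancel_left]
      exact hh.trans_le (min_le_left _ _)
    · intro hmem
      refine hTA (hδ₂s (mem_thickening_iff.2 ⟨_, image_mono ball_subset_closedBall hmem, ?_⟩))
      rw [dist_eq_norm, sub_add_cancel_left, norm_neg]
      exact hh.trans_le (min_le_right _ _)
  have hρm : Measurable (K.indicator ρ) := hρ.1.indicator hKc.isClosed.measurableSet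
  have hρ1 : ∫⁻ x, K.indicator ρ x ≠ ⊤ := by
    have hle : ∀ x, K.indicator ρ x ≤ K.indicator 1 x + ρ x ^ p := fun x => by
      by_cases hx : x ∈ K
      · rw [indicator_of_mem hx, indicator_of_mem hx, Pi.one_apply]
        rcases le_total (ρ x) 1 with h | h
        · exact h.trans le_self_add
        · exact (ENNReal.le_rpow_self_of_one_le h hpq.lt.le).trans le_add_self
      · rw [indicator_of_notMem hx]
        exact zero_le
    refine ne_top_of_le_ne_top ?_ (lintegral_mono hle)
    rw [lintegral_add_right _ (hρ.1.pow_const p), lintegral_indicator_one hKc.isClosed.measurableSet]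
    exact ENNReal.add_ne_top.2 ⟨hKc.measure_lt_top.ne, hfin⟩
  have hmain := one_le_rpow_mul_isoConst hρm hρ1 (lt_min hδ₁ hδ₂) hAb hadm hpq hq2
  have h2 : ∫⁻ x, K.indicator ρ x ^ p ≤ ∫⁻ x, ρ x ^ p := lintegral_mono fun x => by
    gcongr
    · exact hpq.nonneg
    · exact indicator_le_self _ _ _
  have h3 : 1 ≤ (∫⁻ x, ρ x ^ p) * N ^ (p - 1) := by
    have h4 : 1 ≤ ((∫⁻ x, ρ x ^ p) ^ (1 / p) * N ^ (1 / q)) ^ p := by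
      refine ENNReal.one_le_rpow (hmain.trans ?_) hpq.pos
      gcongr
      exact hpq.one_div_nonneg
    rw [ENNReal.mul_rpow_of_nonneg _ _ hpq.nonneg, ← ENNReal.rpow_mul, ← ENNReal.rpow_mul,
      one_div_mul_cancel hpq.ne_zero, ENNReal.rpow_one] at h4
    rwa [show 1 / q * p = p - 1 by
      rw [← hpq.div_conj_eq_sub_one]
      ring] at h4
  refine (ENNReal.inv_le_iff_le_mul (fun h => absurd h hfin) fun h => absurd h ?_).2
    (by rwa [mul_comm])
  exact ENNReal.rpow_ne_top_of_nonneg hp1.le ENNReal.ofReal_ne_top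

theorem abs_deriv_dist_le {γ : ℝ → ℂ} {z₀ : ℂ} {t : ℝ} (hγ : DifferentiableAt ℝ γ t)
    (hs : DifferentiableAt ℝ (fun t => dist (γ t) z₀) t) :
    |deriv (fun t => dist (γ t) z₀) t| ≤ ‖deriv γ t‖ := by
  have h1 := (hasDerivAt_iff_tendsto_slope.1 hγ.hasDerivAt).norm
  have h2 := (hasDerivAt_iff_tendsto_slope.1 hs.hasDerivAt).norm
  refine le_of_tendsto_of_tendsto' h2 h1 fun y => ?_
  rw [slope_def_module, slope_def_module, norm_smul, norm_smul]
  refine mul_le_mul_of_nonneg_left ?_ (norm_nonneg _)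
  rw [Real.norm_eq_abs, ← dist_eq_norm]
  exact abs_dist_sub_le _ _ _

theorem LipschitzWith.volume_image_real_eq_zero {s : ℝ → ℝ} {K : NNReal} (hs : LipschitzWith K s)
    {E : Set ℝ} (hE : volume E = 0) : volume (s '' E) = 0 := by
  have h := hs.hausdorffMeasure_image_le (d := 1) zero_le_one E
  rw [hausdorffMeasure_real, hE, mul_zero] at h
  exact le_antisymm h zero_le

theorem lintegral_Icc_le_lintegral_comp_dist {γ : ℝ → ℂ} {K : NNReal} (hγ : LipschitzWith K γ)
    {z₀ : ℂ} {r₁ r₂ : ℝ} (h0 : dist (γ 0) z₀ ≤ r₁) (h1 : r₂ ≤ dist (γ 1) z₀) {h : ℝ → ℝ≥0∞}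
    (hh : Measurable h) :
    ∫⁻ x in Icc r₁ r₂, h x ≤
      ∫⁻ t in Icc (0 : ℝ) 1, h (dist (γ t) z₀) * (‖deriv γ t‖₊ : ℝ≥0∞) := by
  set s : ℝ → ℝ := fun t => dist (γ t) z₀ with hs
  have hsl : LipschitzWith K s := by
    refine LipschitzWith.of_dist_le_mul fun a b => le_trans ?_ (hγ.dist_le_mul a b)
    rw [Real.dist_eq]
    exact abs_dist_sub_le _ _ _
  have hsm : Measurable s := hsl.continuous.measurable
  have hdm : Measurable fun t => (‖deriv γ t‖₊ : ℝ≥0∞) :=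
    (measurable_deriv γ).nnnorm.coe_nnreal_ennreal
  set μ : Measure ℝ := (volume.restrict (Icc (0 : ℝ) 1)).withDensity fun t => ‖deriv γ t‖₊ with hμ
  have hle : volume.restrict (Icc r₁ r₂) ≤ μ.map s := by
    refine Measure.le_iff.2 fun B hB => ?_
    have hE : MeasurableSet (s ⁻¹' B) := hsm hB
    rw [Measure.restrict_apply hB, Measure.map_apply hsm hB, hμ, withDensity_apply _ hE,
      Measure.restrict_restrict hE]
    set E := s ⁻¹' B ∩ Icc (0 : ℝ) 1 with hEdef
    set F := {t | DifferentiableAt ℝ γ t} ∩ {t | DifferentiableAt ℝ s t} with hF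
    have hFm : MeasurableSet F :=
      (measurableSet_of_differentiableAt ℝ γ).inter (measurableSet_of_differentiableAt ℝ s)
    have hFae : volume Fᶜ = 0 := by
      have := (hγ.ae_differentiableAt_real).and hsl.ae_differentiableAt_real
      exact this
    have hcov : B ∩ Icc r₁ r₂ ⊆ s '' (E ∩ F) ∪ s '' (Fᶜ) := by
      rintro y ⟨hyB, hy⟩
      obtain ⟨t, ht, rfl⟩ := intermediate_value_Icc zero_le_one hsl.continuous.continuousOn
        (show y ∈ Icc (s 0) (s 1) from ⟨h0.trans hy.1, hy.2.trans h1⟩)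
      by_cases htF : t ∈ F
      · exact Or.inl ⟨t, ⟨⟨hyB, ht⟩, htF⟩, rfl⟩
      · exact Or.inr ⟨t, htF, rfl⟩
    have hEm : MeasurableSet (E ∩ F) := (hE.inter measurableSet_Icc).inter hFm
    calc volume (B ∩ Icc r₁ r₂) ≤ volume (s '' (E ∩ F)) + volume (s '' Fᶜ) :=
          (measure_mono hcov).trans (measure_union_le _ _)
      _ = volume (s '' (E ∩ F)) := by rw [hsl.volume_image_real_eq_zero hFae, add_zero]
      _ ≤ ∫⁻ t in E ∩ F, ENNReal.ofReal |deriv s t| := by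
          have := addHaar_image_le_lintegral_abs_det_fderiv volume hEm
            (f := s) (f' := fun t => (ContinuousLinearMap.toSpanSingleton ℝ (deriv s t)))
            fun t ht => ht.2.2.hasDerivAt.hasFDerivAt.hasFDerivWithinAt
          simpa using this
      _ ≤ ∫⁻ t in E ∩ F, ‖deriv γ t‖₊ := by
          refine setLIntegral_mono' hEm fun t ht => ?_
          exact ENNReal.ofReal_le_coe.2 (abs_deriv_dist_le ht.2.1 ht.2.2)
      _ ≤ _ := lintegral_mono_set inter_subset_left
  calc _ ≤ ∫⁻ x, h x ∂(μ.map s) := lintegral_mono' hle le_rfl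
    _ = ∫⁻ t, h (s t) ∂μ := lintegral_map hh hsm
    _ = _ := by
      refine (lintegral_withDensity_eq_lintegral_mul _ hdm (hh.comp hsm)).trans ?_
      refine lintegral_congr fun t => ?_
      rw [Pi.mul_apply, mul_comm]
      rfl

theorem lintegral_Icc_le_lineIntegral {γ : ℝ → ℂ} {z₀ : ℂ} {r₁ r₂ : ℝ}
    (h0 : dist (γ 0) z₀ ≤ r₁) (h1 : r₂ ≤ dist (γ 1) z₀) {h : ℝ → ℝ≥0∞} (hh : Measurable h) :
    ∫⁻ x in Icc r₁ r₂, h x ≤ lineIntegral (fun z => h (dist z z₀)) γ := by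
  unfold lineIntegral
  split_ifs with hγ
  swap
  · exact le_top
  obtain ⟨K, hK⟩ := hγ
  set γ' : ℝ → ℂ := fun t => γ (max 0 (min t 1)) with hγ'
  have hc : LipschitzWith 1 fun t : ℝ => max 0 (min t 1) :=
    (LipschitzWith.id.min_const 1).const_max 0
  have hlip : LipschitzWith K γ' := by
    refine LipschitzWith.of_dist_le_mul fun a b => ?_
    refine (hK.dist_le_mul _ ⟨le_max_left _ _, max_le zero_le_one (min_le_right _ _)⟩ _
      ⟨le_max_left _ _, max_le zero_le_one (min_le_right _ _)⟩).trans ?_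
    gcongr
    simpa using hc.dist_le_mul a b
  have heq : ∀ t ∈ Icc (0 : ℝ) 1, γ' t = γ t := fun t ht => by
    simp only [hγ', min_eq_left ht.2, max_eq_right ht.1]
  refine (lintegral_Icc_le_lintegral_comp_dist hlip (z₀ := z₀) (r₁ := r₁) (r₂ := r₂)
    (by rwa [heq 0 (by simp)]) (by rwa [heq 1 (by simp)]) hh).trans (le_of_eq ?_)
  rw [← restrict_Ioo_eq_restrict_Icc]
  refine setLIntegral_congr_fun measurableSet_Ioo fun t ht => ?_
  have hev : γ' =ᶠ[nhds t] γ := by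
    filter_upwards [isOpen_Ioo.mem_nhds ht] with u hu using heq u ⟨hu.1.le, hu.2.le⟩
  simp only [hev.deriv_eq, hev.eq_of_nhds]

theorem measurable_circleMean {Q : ℂ → ℝ≥0∞} (hQ : Measurable Q) (z₀ : ℂ) :
    Measurable (circleMean Q z₀) := by
  unfold circleMean
  refine Measurable.div_const (Measurable.lintegral_prod_right' (f := fun x : ℝ × ℝ =>
    Q (z₀ + (x.1 : ℂ) * Complex.exp ((x.2 : ℂ) * Complex.I))) ?_) _
  fun_prop

theorem lintegral_Ioo_neg_pi_pi_eq {F : ℝ → ℝ≥0∞} (hF : Function.Periodic F (2 * Real.pi)) :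
    ∫⁻ θ in Ioo (-Real.pi) Real.pi, F θ = ∫⁻ θ in Icc 0 (2 * Real.pi), F θ := by
  rw [restrict_Ioo_eq_restrict_Ioc, ← restrict_Ioc_eq_restrict_Icc]
  have h1 := isAddFundamentalDomain_Ioc Real.two_pi_pos (-Real.pi)
  have h2 := isAddFundamentalDomain_Ioc Real.two_pi_pos 0
  rw [show -Real.pi + 2 * Real.pi = Real.pi by ring] at h1
  rw [zero_add] at h2
  exact h1.setLIntegral_eq h2 F hF.map_vadd_zmultiples

theorem lintegral_mul_comp_dist {Q : ℂ → ℝ≥0∞} (hQ : Measurable Q) (z₀ : ℂ) {g : ℝ → ℝ≥0∞}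
    (hg : Measurable g) :
    ∫⁻ z, Q z * g (dist z z₀) = ∫⁻ t in Ioi 0,
      ENNReal.ofReal (2 * Real.pi) * (ENNReal.ofReal t * circleMean Q z₀ t * g t) := by
  have hpi : ENNReal.ofReal (2 * Real.pi) ≠ 0 := by
    simp [Real.pi_pos]
  rw [← lintegral_add_left_eq_self (fun z => Q z * g (dist z z₀)) z₀,
    ← Complex.lintegral_comp_polarCoord_symm]
  have hpolar : ∀ x : ℝ × ℝ, Complex.polarCoord.symm x =
      (x.1 : ℂ) * Complex.exp ((x.2 : ℂ) * Complex.I) := fun x => by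
    rw [Complex.polarCoord_symm_apply, Complex.exp_mul_I]
    push_cast
    rfl
  simp_rw [hpolar]
  rw [show polarCoord.target = Ioi (0 : ℝ) ×ˢ Ioo (-Real.pi) Real.pi from rfl,
    Measure.volume_eq_prod, ← Measure.prod_restrict, lintegral_prod]
  swap
  · refine Measurable.aemeasurable ?_
    simp only [smul_eq_mul]
    fun_prop
  refine setLIntegral_congr_fun measurableSet_Ioi fun t (ht : 0 < t) => ?_
  have hd : ∀ θ : ℝ, dist (z₀ + (t : ℂ) * Complex.exp ((θ : ℂ) * Complex.I)) z₀ = t := fun θ => by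
    rw [dist_eq_norm, add_sub_cancel_left, norm_mul, Complex.norm_exp_ofReal_mul_I, mul_one,
      Complex.norm_real, Real.norm_eq_abs, abs_of_pos ht]
  have hm : Measurable fun θ : ℝ => Q (z₀ + (t : ℂ) * Complex.exp ((θ : ℂ) * Complex.I)) := by
    fun_prop
  have hper : Function.Periodic
      (fun θ : ℝ => Q (z₀ + (t : ℂ) * Complex.exp ((θ : ℂ) * Complex.I))) (2 * Real.pi) :=
    fun θ => by
      have : ((θ + 2 * Real.pi : ℝ) : ℂ) * Complex.I = θ * Complex.I + 2 * Real.pi * Complex.I := by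
        push_cast
        ring
      simp only [this, Complex.exp_periodic (θ * Complex.I)]
  simp only [smul_eq_mul, hd]
  rw [lintegral_const_mul _ (hm.mul_const _), lintegral_mul_const _ hm,
    lintegral_Ioo_neg_pi_pi_eq hper, circleMean]
  set I := ∫⁻ θ in Icc (0 : ℝ) (2 * Real.pi),
    Q (z₀ + (t : ℂ) * Complex.exp ((θ : ℂ) * Complex.I)) with hI
  have hI' : ENNReal.ofReal (2 * Real.pi) * (I / ENNReal.ofReal (2 * Real.pi)) = I :=
    ENNReal.mul_div_cancel hpi ENNReal.ofReal_ne_top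
  calc _ = ENNReal.ofReal t * (ENNReal.ofReal (2 * Real.pi) *
        (I / ENNReal.ofReal (2 * Real.pi)) * g t) := by rw [hI']
    _ = _ := by ring

/-- Upper bound for the modulus of the image of the curves of a ring under a `Q`-homeomorphism. -/
theorem IsQHomeo.pModulus_mul_rpow_le {p : ℝ} (hp : 1 < p) {D : Set ℂ} {Q : ℂ → ℝ≥0∞}
    (hQ : Measurable Q) {f : ℂ → ℂ} (hf : IsQHomeo p D Q f) {z₀ : ℂ} {r₁ r₂ : ℝ}
    (hball : closedBall z₀ r₂ ⊆ D) {h : ℝ → ℝ≥0∞} (hh : Measurable h)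
    (hhQ : ∀ t, h t ^ (p - 1) * (ENNReal.ofReal t * circleMean Q z₀ t) ≤ 1)
    (hJ : ∫⁻ t in Icc r₁ r₂, h t ≠ ⊤) :
    pModulus p ((fun γ => f ∘ γ) '' ringCurves z₀ r₁ r₂) * (∫⁻ t in Icc r₁ r₂, h t) ^ (p - 1) ≤
      ENNReal.ofReal (2 * Real.pi) := by
  set J := ∫⁻ t in Icc r₁ r₂, h t with hJdef
  have hp0 : 0 < p := by linarith
  have hp1 : 0 < p - 1 := by linarith
  rcases eq_or_ne J 0 with hJ0 | hJ0
  · rw [hJ0, ENNReal.zero_rpow_of_pos hp1, mul_zero]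
    exact zero_le
  set h' : ℝ → ℝ≥0∞ := fun t => J⁻¹ * (Icc r₁ r₂).indicator h t with hh'
  have hh'm : Measurable h' := (hh.indicator measurableSet_Icc).const_mul _
  have hadm : IsAdmissible (fun z => h' (dist z z₀)) (ringCurves z₀ r₁ r₂) := by
    refine ⟨by fun_prop, fun γ hγ => ?_⟩
    refine le_trans (le_of_eq ?_) (lintegral_Icc_le_lineIntegral hγ.2.2.1 hγ.2.2.2 hh'm)
    rw [lintegral_const_mul _ (hh.indicator measurableSet_Icc),
      setLIntegral_indicator measurableSet_Icc, inter_self, ← hJdef, ENNReal.inv_mul_cancel hJ0 hJ]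
  have hfam : CurveFamilyIn (ringCurves z₀ r₁ r₂) D :=
    fun γ hγ => ⟨hγ.1, fun t ht => hball (hγ.2.1 t ht)⟩
  have hmain : pModulus p ((fun γ => f ∘ γ) '' ringCurves z₀ r₁ r₂) ≤
      ENNReal.ofReal (2 * Real.pi) * (J⁻¹ ^ p * J) := by
    refine (hf.2 _ hfam _ hadm).trans ((setLIntegral_le_lintegral _ _).trans ?_)
    rw [lintegral_mul_comp_dist hQ z₀ (g := fun t => h' t ^ p) (hh'm.pow_const p)]
    have hle : ∀ t, ENNReal.ofReal (2 * Real.pi) *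
        (ENNReal.ofReal t * circleMean Q z₀ t * h' t ^ p) ≤
        ENNReal.ofReal (2 * Real.pi) * (J⁻¹ ^ p * (Icc r₁ r₂).indicator h t) := fun t => by
      refine mul_le_mul' le_rfl ?_
      rw [ENNReal.mul_rpow_of_nonneg _ _ hp0.le]
      by_cases ht : t ∈ Icc r₁ r₂
      · rw [indicator_of_mem ht]
        have h1 : h t ^ p = h t ^ (p - 1) * h t := by
          have := ENNReal.rpow_add_of_nonneg (x := h t) (p - 1) 1 hp1.le zero_le_one
          rwa [_root_.sub_add_cancel, ENNReal.rpow_one] at this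
        calc _ = J⁻¹ ^ p * (h t ^ (p - 1) * (ENNReal.ofReal t * circleMean Q z₀ t) * h t) := by
              rw [h1]
              ring
          _ ≤ J⁻¹ ^ p * (1 * h t) := by
              gcongr
              exact hhQ t
          _ = _ := by rw [one_mul]
      · rw [indicator_of_notMem ht, ENNReal.zero_rpow_of_pos hp0]
        simp
    refine (lintegral_mono hle).trans ((setLIntegral_le_lintegral _ _).trans (le_of_eq ?_))
    have hm := hh.indicator (measurableSet_Icc (a := r₁) (b := r₂))
    rw [lintegral_const_mul _ (hm.const_mul _), lintegral_const_mul _ hm,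
      lintegral_indicator measurableSet_Icc]
  have hJp : J ^ p = J * J ^ (p - 1) := by
    have := ENNReal.rpow_add 1 (p - 1) hJ0 hJ
    rwa [ENNReal.rpow_one, _root_.add_sub_cancel] at this
  calc _ ≤ ENNReal.ofReal (2 * Real.pi) * (J⁻¹ ^ p * J) * J ^ (p - 1) := by gcongr
    _ = ENNReal.ofReal (2 * Real.pi) * (J⁻¹ ^ p * J ^ p) := by
        rw [hJp]
        ring
    _ = ENNReal.ofReal (2 * Real.pi) := by
        rw [← ENNReal.mul_rpow_of_nonneg _ _ hp0.le, ENNReal.inv_mul_cancel hJ0 hJ,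
          ENNReal.one_rpow, mul_one]

theorem closedBall_subset_of_lt_infDist_frontier {D : Set ℂ} (hD : IsOpen D) {z₀ : ℂ}
    (hz₀ : z₀ ∈ D) {r : ℝ} (hr0 : 0 ≤ r) (hr : r < infDist z₀ (frontier D)) :
    closedBall z₀ r ⊆ D := by
  have hpre : IsPreconnected (closedBall z₀ r) := (convex_closedBall z₀ r).isPreconnected
  have hcov : closedBall z₀ r ⊆ D ∪ (closure D)ᶜ := by
    intro y hy
    by_contra hyn
    rw [mem_union, mem_compl_iff, not_or, not_not] at hyn
    have h1 := infDist_le_dist_of_mem (x := z₀) (show y ∈ frontier D by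
      rw [hD.frontier_eq]
      exact ⟨hyn.2, hyn.1⟩)
    rw [dist_comm] at h1
    exact absurd (hr.trans_le h1) (not_lt.2 hy)
  exact hpre.subset_left_of_subset_union hD isClosed_closure.isOpen_compl
    (disjoint_compl_right.mono_left subset_closure) hcov ⟨z₀, mem_closedBall_self hr0, hz₀⟩

theorem pi_mul_rpow_mul_isoConst_eq {p v : ℝ} (hp : 2 < p) (hv : 0 < v) :
    Real.pi * ((p - 2) / (p - 1)) ^ (2 * (p - 1) / (p - 2)) *
      ((2 * Real.pi) ^ (1 / (p - 1)) * isoConst (p / (p - 1)) v) ^ (2 * (p - 1) / (p - 2)) = v := by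
  have hp1 : 0 < p - 1 := by linarith
  have hp2 : 0 < p - 2 := by linarith
  have hpi := Real.pi_pos
  have h1 : 1 - p / (p - 1) / 2 = (p - 2) / (p - 1) * 2⁻¹ := by
    field_simp
    ring
  have hc : 0 < (p - 2) / (p - 1) := by positivity
  unfold isoConst
  rw [h1]
  obtain ⟨c, hcdef⟩ : ∃ c, c = (p - 2) / (p - 1) := ⟨_, rfl⟩
  rw [← hcdef] at hc ⊢
  apply Real.log_injOn_pos (mem_Ioi.2 (by positivity)) (mem_Ioi.2 hv)
  rw [Real.log_mul (by positivity) (by positivity), Real.log_mul (by positivity) (by positivity),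
    Real.log_rpow hc, Real.log_rpow (by positivity), Real.log_mul (by positivity) (by positivity),
    Real.log_rpow (by positivity), Real.log_mul (by positivity) (by positivity),
    Real.log_mul (by positivity) (by positivity), Real.log_rpow (by positivity),
    Real.log_mul (by positivity) (by positivity), Real.log_sqrt hpi.le,
    Real.log_div (by positivity) (by positivity), Real.log_rpow hv,
    Real.log_mul (by positivity) (by positivity), Real.log_inv]
  generalize Real.log c = L
  rw [hcdef]
  field_simp
  ring

/-- Bound for the radial integral of a density `h` with `h^{p-1} t q(t) ≤ 1`. -/
theorem IsQHomeo.lintegral_Icc_le {p : ℝ} (hp : 2 < p) {D : Set ℂ} (hD : IsOpen D)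
    {Q : ℂ → ℝ≥0∞} (hQ : Measurable Q) {f : ℂ → ℂ} (hf : IsQHomeo p D Q f)
    (hD' : Bornology.IsBounded (f '' D)) {z₀ : ℂ} {r₁ r₂ r : ℝ} (hr₁ : 0 < r₁)
    (hr₂ : r₁ < r₂) (hr : r₂ < r) (hball : closedBall z₀ r ⊆ D) {h : ℝ → ℝ≥0∞} (hh : Measurable h)
    (hhQ : ∀ t, h t ^ (p - 1) * (ENNReal.ofReal t * circleMean Q z₀ t) ≤ 1)
    (hJ : ∫⁻ t in Icc r₁ r₂, h t ≠ ⊤) :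
    ∫⁻ t in Icc r₁ r₂, h t ≤ ENNReal.ofReal ((2 * Real.pi) ^ (1 / (p - 1)) *
      isoConst (p / (p - 1)) (volume (f '' ball z₀ r)).toReal) := by
  have hp1 : 0 < p - 1 := by linarith
  have hpq : p.HolderConjugate (p / (p - 1)) := Real.HolderConjugate.conjExponent (by linarith)
  have hq2 : p / (p - 1) < 2 := by
    rw [div_lt_iff₀ hp1]
    linarith
  have hbD : ball z₀ r ⊆ D := ball_subset_closedBall.trans hball
  have hv : 0 < (volume (f '' ball z₀ r)).toReal :=
    ENNReal.toReal_pos ((hf.1.2.2 _ hbD isOpen_ball).measure_pos volume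
      ⟨f z₀, z₀, mem_ball_self (by linarith), rfl⟩).ne'
      (hD'.subset (image_mono hbD)).measure_lt_top.ne
  set N := ENNReal.ofReal (isoConst (p / (p - 1)) (volume (f '' ball z₀ r)).toReal) with hN
  have hN0 : N ≠ 0 := (ENNReal.ofReal_pos.2 (isoConst_pos hq2 hv)).ne'
  have h1 := hf.1.inv_isoConst_rpow_le_pModulus hD hD' hr₁ hr₂ hr hball hpq hq2
  have h2 := hf.pModulus_mul_rpow_le (by linarith) hQ (r₁ := r₁)
    ((closedBall_subset_closedBall hr.le).trans hball) hh hhQ hJ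
  rw [← hN] at h1
  set J := ∫⁻ t in Icc r₁ r₂, h t
  have h3 : J ^ (p - 1) ≤ ENNReal.ofReal (2 * Real.pi) * N ^ (p - 1) := by
    have h4 : (N ^ (p - 1))⁻¹ * J ^ (p - 1) ≤ ENNReal.ofReal (2 * Real.pi) :=
      (mul_le_mul' h1 le_rfl).trans h2
    rw [mul_comm, ← div_eq_mul_inv] at h4
    exact (ENNReal.div_le_iff (ENNReal.rpow_pos hN0.bot_lt ENNReal.ofReal_ne_top).ne'
      (ENNReal.rpow_ne_top_of_nonneg hp1.le ENNReal.ofReal_ne_top)).1 h4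
  have h5 := ENNReal.rpow_le_rpow h3 (z := 1 / (p - 1)) (by positivity)
  rw [ENNReal.mul_rpow_of_nonneg _ _ (by positivity), ← ENNReal.rpow_mul, ← ENNReal.rpow_mul,
    mul_one_div_cancel hp1.ne', ENNReal.rpow_one, ENNReal.rpow_one,
    ENNReal.ofReal_rpow_of_pos (by positivity), hN, ← ENNReal.ofReal_mul (by positivity)] at h5
  exact h5

theorem iSup_min_natCast (a : ℝ≥0∞) : ⨆ n : ℕ, min a n = a := by
  refine le_antisymm (iSup_le fun n => min_le_left _ _) ?_
  rcases eq_or_ne a ⊤ with rfl | ha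
  · simp [ENNReal.iSup_natCast]
  · obtain ⟨n, hn⟩ := ENNReal.exists_nat_gt ha
    exact le_iSup_of_le n (by rw [min_eq_left hn.le])

theorem IsQHomeo.lintegral_Ioo_le {p : ℝ} (hp : 2 < p) {D : Set ℂ} (hD : IsOpen D)
    {Q : ℂ → ℝ≥0∞} (hQ : Measurable Q) {f : ℂ → ℂ} (hf : IsQHomeo p D Q f)
    (hD' : Bornology.IsBounded (f '' D)) {z₀ : ℂ} {r : ℝ} (hr : 0 < r)
    (hball : closedBall z₀ r ⊆ D) :
    ∫⁻ t in Ioo 0 r, (ENNReal.ofReal t ^ (1 / (p - 1)) * circleMean Q z₀ t ^ (1 / (p - 1)))⁻¹ ≤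
      ENNReal.ofReal ((2 * Real.pi) ^ (1 / (p - 1)) *
        isoConst (p / (p - 1)) (volume (f '' ball z₀ r)).toReal) := by
  have hp1 : 0 < p - 1 := by linarith
  set F : ℝ → ℝ≥0∞ := fun t =>
    (ENNReal.ofReal t ^ (1 / (p - 1)) * circleMean Q z₀ t ^ (1 / (p - 1)))⁻¹ with hF
  have hFm : Measurable F := by
    have := measurable_circleMean hQ z₀
    fun_prop
  have hFQ : ∀ t, F t ^ (p - 1) * (ENNReal.ofReal t * circleMean Q z₀ t) ≤ 1 := fun t => by
    have h1 : ENNReal.ofReal t * circleMean Q z₀ t =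
        (ENNReal.ofReal t ^ (1 / (p - 1)) * circleMean Q z₀ t ^ (1 / (p - 1))) ^ (p - 1) := by
      rw [ENNReal.mul_rpow_of_nonneg _ _ hp1.le, ← ENNReal.rpow_mul, ← ENNReal.rpow_mul,
        one_div_mul_cancel hp1.ne', ENNReal.rpow_one, ENNReal.rpow_one]
    rw [h1, ← ENNReal.mul_rpow_of_nonneg _ _ hp1.le]
    exact ENNReal.rpow_le_one (ENNReal.inv_mul_le_one _) hp1.le
  have hIcc : ∀ r₁ r₂, 0 < r₁ → r₁ < r₂ → r₂ < r → ∫⁻ t in Icc r₁ r₂, F t ≤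
      ENNReal.ofReal ((2 * Real.pi) ^ (1 / (p - 1)) *
        isoConst (p / (p - 1)) (volume (f '' ball z₀ r)).toReal) := by
    intro r₁ r₂ h1 h2 h3
    rw [← lintegral_congr (fun t => iSup_min_natCast (F t)), lintegral_iSup]
    · refine iSup_le fun n => hf.lintegral_Icc_le hp hD hQ hD' h1 h2 h3 hball
        (hFm.min measurable_const) (fun t => ?_) ?_
      · refine le_trans ?_ (hFQ t)
        gcongr
        exact min_le_left _ _
      · refine ne_top_of_le_ne_top ?_ (lintegral_mono fun t => min_le_right (F t) (n : ℝ≥0∞))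
        rw [setLIntegral_const, Real.volume_Icc]
        exact ENNReal.mul_ne_top (ENNReal.natCast_ne_top n) ENNReal.ofReal_ne_top
    · exact fun n => hFm.min measurable_const
    · intro m n hmn t
      exact min_le_min le_rfl (by exact_mod_cast hmn)
  have hlim : Filter.Tendsto (fun n : ℕ => r / 3 * (1 / ((n : ℝ) + 1))) Filter.atTop (nhds 0) := by
    simpa using tendsto_one_div_add_atTop_nhds_zero_nat.const_mul (r / 3)
  have hcov := aecover_Ioo_of_Icc (μ := volume) hlim
    (by simpa using hlim.const_sub r :
      Filter.Tendsto (fun n : ℕ => r - r / 3 * (1 / ((n : ℝ) + 1))) Filter.atTop (nhds r))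
  refine le_of_tendsto' (hcov.lintegral_tendsto_of_countably_generated hFm.aemeasurable)
    fun n => ?_
  have hn1 : 0 < 1 / ((n : ℝ) + 1) := by positivity
  have hn2 : 1 / ((n : ℝ) + 1) ≤ 1 := by
    rw [div_le_one (by positivity)]
    linarith [(Nat.cast_nonneg n : (0 : ℝ) ≤ n)]
  have hn3 : 0 < r / 3 * (1 / ((n : ℝ) + 1)) := by positivity
  have hn4 : r / 3 * (1 / ((n : ℝ) + 1)) ≤ r / 3 := mul_le_of_le_one_right (by positivity) hn2
  rw [Measure.restrict_restrict measurableSet_Icc, inter_eq_left.2]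
  · exact hIcc _ _ hn3 (by linarith) (by linarith)
  · exact fun t ht => ⟨by linarith [ht.1], by linarith [ht.2]⟩
/-- **Theorem 1.** Let `D`, `D'` be bounded domains in `ℂ`, `p > 2`, and
`f : D → D'` a `Q`-homeomorphism w.r.t. the `p`-modulus with `Q ∈ L¹_loc(D \ {z₀})`.
Then for all `r ∈ (0, d₀)`, `d₀ = dist(z₀, ∂D)`,
`|fB(z₀,r)| ≥ π ((p-2)/(p-1))^{2(p-1)/(p-2)} (∫₀^r dt/(t^{1/(p-1)} q_{z₀}(t)^{1/(p-1)}))^{2(p-1)/(p-2)}`. -/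
theorem area_image_disc_lower_bound
    (p : ℝ) (hp : 2 < p) (D D' : Set ℂ)
    (hDo : IsOpen D) (hDc : IsConnected D) (hDb : Bornology.IsBounded D)
    (hD'o : IsOpen D') (hD'c : IsConnected D') (hD'b : Bornology.IsBounded D')
    (Q : ℂ → ℝ≥0∞) (hQmeas : Measurable Q)
    (f : ℂ → ℂ) (hf : IsQHomeo p D Q f) (hfD : f '' D = D')
    (z₀ : ℂ) (hz₀ : z₀ ∈ D)
    (hQloc : MeasureTheory.LocallyIntegrableOn (fun z => (Q z).toReal) (D \ {z₀}))
    (r : ℝ) (hr0 : 0 < r) (hr : r < Metric.infDist z₀ (frontier D)) :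
    ENNReal.ofReal (Real.pi * ((p - 2) / (p - 1)) ^ (2 * (p - 1) / (p - 2))) *
        (∫⁻ t in Set.Ioo (0 : ℝ) r,
          (ENNReal.ofReal t ^ (1 / (p - 1)) * circleMean Q z₀ t ^ (1 / (p - 1)))⁻¹) ^
          (2 * (p - 1) / (p - 2)) ≤
      volume (f '' Metric.closedBall z₀ r) := by
  have hball := closedBall_subset_of_lt_infDist_frontier hDo hz₀ hr0.le hr
  have hbD : ball z₀ r ⊆ D := ball_subset_closedBall.trans hball
  rw [← hfD] at hD'b
  have hJ := hf.lintegral_Ioo_le hp hDo hQmeas hD'b hr0 hball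
  have hp1 : 0 < p - 1 := by linarith
  have hp2 : 0 < p - 2 := by linarith
  have hq2 : p / (p - 1) < 2 := by
    rw [div_lt_iff₀ hp1]
    linarith
  have hfin := (hD'b.subset (image_mono hbD)).measure_lt_top (μ := volume).ne
  have hv : 0 < (volume (f '' ball z₀ r)).toReal :=
    ENNReal.toReal_pos ((hf.1.2.2 _ hbD isOpen_ball).measure_pos volume
      ⟨f z₀, z₀, mem_ball_self hr0, rfl⟩).ne' hfin
  have hiso := isoConst_pos hq2 hv
  calc _ ≤ ENNReal.ofReal (Real.pi * ((p - 2) / (p - 1)) ^ (2 * (p - 1) / (p - 2))) *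
        ENNReal.ofReal ((2 * Real.pi) ^ (1 / (p - 1)) *
          isoConst (p / (p - 1)) (volume (f '' ball z₀ r)).toReal) ^ (2 * (p - 1) / (p - 2)) := by
        gcongr
    _ = volume (f '' ball z₀ r) := by
        rw [ENNReal.ofReal_rpow_of_pos (by positivity), ← ENNReal.ofReal_mul (by positivity),
          pi_mul_rpow_mul_isoConst_eq hp hv, ENNReal.ofReal_toReal hfin]
    _ ≤ _ := measure_mono (image_mono ball_subset_closedBall)
end
end

section
/- Let D and D' be bounded domains in ℂ, let p > 2, and let f : D → D' be a Q-homeomorphism with respect to the p-modulus such that q_{z₀}(t) ≤ q₀ < ∞ for almost every t ∈ (0, d₀), where d₀ = dist(z₀, ∂D). Then for all r ∈ (0, d₀), |f(B(z₀,r))| ≥ q₀^{2/(2−p)} · |B(z₀,r)|. -/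
open MeasureTheory Set Metric Complex ENNReal

noncomputable section

lemma lintegral_eq_polar {g : ℂ → ℝ≥0∞} (hg : Measurable g) (w : ℂ) :
    ∫⁻ z, g z = ∫⁻ θ in Ioo (-Real.pi) Real.pi, ∫⁻ s in Ioi (0 : ℝ),
      ENNReal.ofReal s * g (w + s * exp (θ * I)) := by
  rw [← lintegral_add_left_eq_self (μ := volume) g w, ← Complex.lintegral_comp_polarCoord_symm,
    polarCoord_target, Measure.volume_eq_prod, ← Measure.prod_restrict,
    lintegral_prod_symm _ (by
      simp only [Complex.polarCoord_symm_apply, smul_eq_mul]; fun_prop)]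
  simp [Complex.polarCoord_symm_apply, Complex.exp_mul_I]

lemma lintegral_eq_polar_swap {g : ℂ → ℝ≥0∞} (hg : Measurable g) (w : ℂ) :
    ∫⁻ z, g z = ∫⁻ s in Ioi (0 : ℝ), ENNReal.ofReal s *
      ∫⁻ θ in Ioo (-Real.pi) Real.pi, g (w + s * exp (θ * I)) := by
  rw [lintegral_eq_polar hg w, lintegral_lintegral_swap (by fun_prop)]
  refine lintegral_congr fun s => ?_
  rw [lintegral_const_mul _ (by fun_prop)]

lemma lintegral_angle_eq (h : ℂ → ℝ≥0∞) :
    ∫⁻ θ in Ioo (-Real.pi) Real.pi, h (exp ((θ : ℝ) * I)) =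
      ∫⁻ θ in Icc 0 (2 * Real.pi), h (exp ((θ : ℝ) * I)) := by
  rw [Measure.restrict_congr_set Ioo_ae_eq_Ioc, Measure.restrict_congr_set Ioc_ae_eq_Icc.symm]
  have h1 := isAddFundamentalDomain_Ioc Real.two_pi_pos (-Real.pi)
  have h2 := isAddFundamentalDomain_Ioc Real.two_pi_pos 0
  rw [show -Real.pi + 2 * Real.pi = Real.pi by ring] at h1
  rw [zero_add] at h2
  refine h1.setLIntegral_eq h2 _ ?_
  rintro ⟨g, hg⟩ x
  obtain ⟨n, rfl⟩ := AddSubgroup.mem_zmultiples_iff.1 hg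
  congr 1
  refine Complex.exp_eq_exp_iff_exists_int.2 ⟨n, ?_⟩
  simp [AddSubgroup.vadd_def]
  ring

lemma exists_first_exit_s2 {V : Set ℂ} (hV : IsOpen V) (hVb : Bornology.IsBounded V) {w e : ℂ}
    (hw : w ∈ V) (he : ‖e‖ = 1) :
    ∃ l : ℝ, 0 < l ∧ (∀ s ∈ Ico 0 l, w + s * e ∈ V) ∧ w + l * e ∉ V := by
  set T : Set ℝ := {s | 0 ≤ s ∧ w + s * e ∉ V} with hT
  have hTc : IsClosed T := by
    have : T = Ici 0 ∩ (fun s : ℝ => w + s * e) ⁻¹' Vᶜ := rfl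
    rw [this]
    exact isClosed_Ici.inter (hV.isClosed_compl.preimage (by fun_prop))
  have hTn : T.Nonempty := by
    obtain ⟨M, hM⟩ := hVb.subset_ball w
    refine ⟨|M|, abs_nonneg M, fun h => ?_⟩
    have := hM h
    simp [he] at this
    exact absurd this (not_lt.2 (le_abs_self M))
  have hTb : BddBelow T := ⟨0, fun s hs => hs.1⟩
  have hmem : sInf T ∈ T := hTc.csInf_mem hTn hTb
  refine ⟨sInf T, lt_of_le_of_ne hmem.1 fun h => ?_, fun s hs => ?_, hmem.2⟩
  · apply hmem.2
    rw [← h]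
    simpa using hw
  · by_contra h
    exact absurd (csInf_le hTb ⟨hs.1, h⟩) (not_le.2 hs.2)

lemma lintegral_rpow_sub_one {b l : ℝ} (hb : 0 < b) (hl : 0 ≤ l) :
    ∫⁻ s in Ioo 0 l, ENNReal.ofReal (s ^ (b - 1)) = ENNReal.ofReal (l ^ b / b) := by
  have hi : IntervalIntegrable (fun s : ℝ => s ^ (b - 1)) volume 0 l :=
    intervalIntegral.intervalIntegrable_rpow' (by linarith)
  have h := integral_rpow (a := 0) (b := l) (r := b - 1) (Or.inl (by linarith))
  rw [sub_add_cancel, Real.zero_rpow hb.ne', sub_zero] at h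
  rw [← h, intervalIntegral.integral_of_le hl, Measure.restrict_congr_set Ioo_ae_eq_Ioc,
    ofReal_integral_eq_lintegral_ofReal
      ((intervalIntegrable_iff_integrableOn_Ioc_of_le hl).1 hi)]
  filter_upwards [self_mem_ae_restrict measurableSet_Ioc] with s hs
  exact Real.rpow_nonneg hs.1.le _

lemma young_radial {p c s x : ℝ} (hp : 1 < p) (hc : 0 < c) (hs : 0 < s) (hx : 0 ≤ x) :
    p * c ^ (p - 1) * x ≤ s * x ^ p + (p - 1) * c ^ p * s ^ (-1 / (p - 1)) := by
  have hp0 : 0 < p := by linarith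
  have hp1 : 0 < p - 1 := by linarith
  have h := Real.young_inequality_of_nonneg (a := s ^ (1 / p) * x) (b := c ^ (p - 1) * s ^ (-1 / p))
    (by positivity) (by positivity) (Real.HolderConjugate.conjExponent hp)
  have e1 : (s ^ (1 / p) * x) ^ p = s * x ^ p := by
    rw [Real.mul_rpow (by positivity) hx, ← Real.rpow_mul hs.le, one_div_mul_cancel hp0.ne',
      Real.rpow_one]
  have e2 : (c ^ (p - 1) * s ^ (-1 / p)) ^ (p / (p - 1)) = c ^ p * s ^ (-1 / (p - 1)) := by
    rw [Real.mul_rpow (by positivity) (by positivity), ← Real.rpow_mul hs.le, ← Real.rpow_mul hc.le]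
    congr 2 <;> field_simp
  have e3 : s ^ (1 / p) * x * (c ^ (p - 1) * s ^ (-1 / p)) = c ^ (p - 1) * x := by
    have : s ^ (1 / p) * s ^ (-1 / p) = 1 := by
      rw [← Real.rpow_add hs, ← add_div]; simp
    linear_combination (c ^ (p - 1) * x) * this
  rw [Real.conjExponent, e1, e2, e3] at h
  have h' := mul_le_mul_of_nonneg_left h hp0.le
  have e4 : p * (s * x ^ p / p + c ^ p * s ^ (-1 / (p - 1)) / (p / (p - 1))) =
      s * x ^ p + (p - 1) * c ^ p * s ^ (-1 / (p - 1)) := by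
    field_simp
  rw [e4] at h'
  linarith

lemma young_radial_ennreal {p c s : ℝ} (hp : 1 < p) (hc : 0 < c) (hs : 0 < s) (x : ℝ≥0∞) :
    ENNReal.ofReal (p * c ^ (p - 1)) * x ≤ ENNReal.ofReal s * x ^ p +
      ENNReal.ofReal ((p - 1) * c ^ p) * ENNReal.ofReal (s ^ (-1 / (p - 1))) := by
  have hp0 : 0 < p := by linarith
  have hp1 : 0 < p - 1 := by linarith
  rcases eq_or_ne x ⊤ with rfl | hx
  · simp [ENNReal.top_rpow_of_pos hp0, hs]
  · lift x to NNReal using hx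
    rw [← ENNReal.ofReal_coe_nnreal, ENNReal.ofReal_rpow_of_nonneg x.coe_nonneg hp0.le,
      ← ENNReal.ofReal_mul (by positivity), ← ENNReal.ofReal_mul (by positivity),
      ← ENNReal.ofReal_mul (by positivity), ← ENNReal.ofReal_add (by positivity) (by positivity)]
    exact ENNReal.ofReal_le_ofReal (young_radial hp hc hs x.coe_nonneg)

lemma rpow_div_le_tangent {b l R : ℝ} (hb : 0 < b) (hb1 : b < 1) (hl : 0 < l) (hR : 0 < R) :
    l ^ b / b ≤ R ^ b * (1 / b - 1 / 2) + R ^ (b - 2) * (l ^ (2 : ℝ) / 2) := by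
  have h := rpow_one_add_le_one_add_mul_self (s := l ^ 2 / R ^ 2 - 1) (p := b / 2)
    (by have : 0 < l ^ 2 / R ^ 2 := by positivity
        linarith) (by positivity) (by linarith)
  have e : (1 + (l ^ 2 / R ^ 2 - 1)) ^ (b / 2) = l ^ b / R ^ b := by
    rw [add_sub_cancel, ← div_pow, ← Real.rpow_natCast, ← Real.rpow_mul (by positivity),
      Real.div_rpow hl.le hR.le]
    congr 2 <;> push_cast <;> ring
  rw [e, div_le_iff₀ (by positivity)] at h
  have e2 : R ^ (b - 2) = R ^ b / R ^ 2 := by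
    rw [Real.rpow_sub hR]; norm_num
  rw [e2, div_le_iff₀ hb, Real.rpow_two]
  refine h.trans (le_of_eq ?_)
  field_simp
  ring

lemma ray_inequality {p c R l : ℝ} (hp : 2 < p) (hc : 0 < c) (hR : 0 < R) (hl : 0 < l)
    {g : ℝ → ℝ≥0∞} (hg : Measurable g) (h1 : 1 ≤ ∫⁻ s in Ioo 0 l, g s) :
    ENNReal.ofReal (p * c ^ (p - 1)) ≤
      (∫⁻ s in Ioo 0 l, ENNReal.ofReal s *
        (g s ^ p + ENNReal.ofReal ((p - 1) * c ^ p * R ^ ((p - 2) / (p - 1) - 2)))) +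
      ENNReal.ofReal ((p - 1) * c ^ p *
        (R ^ ((p - 2) / (p - 1)) * (1 / ((p - 2) / (p - 1)) - 1 / 2))) := by
  have hp1 : 0 < p - 1 := by linarith
  have hp2 : 0 < p - 2 := by linarith
  set b := (p - 2) / (p - 1) with hbdef
  have hb : 0 < b := by positivity
  have hb1 : b < 1 := by rw [hbdef, div_lt_one hp1]; linarith
  have hbe : -1 / (p - 1) = b - 1 := by rw [hbdef]; field_simp; ring
  have hbb : 0 ≤ 1 / b - 1 / 2 := by
    have : 1 ≤ 1 / b := by rw [le_div_iff₀ hb]; linarith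
    linarith
  set A := (p - 1) * c ^ p with hA
  have hA0 : 0 ≤ A := by positivity
  have hlin : ∫⁻ s in Ioo 0 l, ENNReal.ofReal s = ENNReal.ofReal (l ^ (2 : ℝ) / 2) := by
    rw [← lintegral_rpow_sub_one two_pos hl.le]
    norm_num
  have htan : ∫⁻ s in Ioo 0 l, ENNReal.ofReal (s ^ (b - 1)) ≤
      ENNReal.ofReal (R ^ b * (1 / b - 1 / 2)) +
        ENNReal.ofReal (R ^ (b - 2)) * ∫⁻ s in Ioo 0 l, ENNReal.ofReal s := by
    rw [lintegral_rpow_sub_one hb hl.le, hlin, ← ENNReal.ofReal_mul (by positivity),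
      ← ENNReal.ofReal_add (by positivity) (by positivity)]
    exact ENNReal.ofReal_le_ofReal (rpow_div_le_tangent hb hb1 hl hR)
  calc ENNReal.ofReal (p * c ^ (p - 1))
      ≤ ENNReal.ofReal (p * c ^ (p - 1)) * ∫⁻ s in Ioo 0 l, g s := le_mul_of_one_le_right' h1
    _ = ∫⁻ s in Ioo 0 l, ENNReal.ofReal (p * c ^ (p - 1)) * g s :=
        (lintegral_const_mul _ hg).symm
    _ ≤ ∫⁻ s in Ioo 0 l, (ENNReal.ofReal s * g s ^ p +
          ENNReal.ofReal A * ENNReal.ofReal (s ^ (b - 1))) := by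
        refine setLIntegral_mono (by fun_prop) fun s hs => ?_
        rw [← hbe]
        exact young_radial_ennreal (by linarith) hc hs.1 _
    _ = (∫⁻ s in Ioo 0 l, ENNReal.ofReal s * g s ^ p) +
          ENNReal.ofReal A * ∫⁻ s in Ioo 0 l, ENNReal.ofReal (s ^ (b - 1)) := by
        rw [lintegral_add_left (by fun_prop), lintegral_const_mul _ (by fun_prop)]
    _ ≤ (∫⁻ s in Ioo 0 l, ENNReal.ofReal s * g s ^ p) + ENNReal.ofReal A *
          (ENNReal.ofReal (R ^ b * (1 / b - 1 / 2)) +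
            ENNReal.ofReal (R ^ (b - 2)) * ∫⁻ s in Ioo 0 l, ENNReal.ofReal s) := by gcongr
    _ = _ := by
        simp_rw [mul_add]
        rw [lintegral_add_left (by fun_prop), lintegral_mul_const _ (by fun_prop),
          ENNReal.ofReal_mul hA0, ENNReal.ofReal_mul hA0]
        ring

lemma lintegral_rpow_lower_bound {p c R : ℝ} (hp : 2 < p) (hc : 0 < c) (hR : 0 < R)
    {V : Set ℂ} (hV : MeasurableSet V) (hvol : volume V ≤ ENNReal.ofReal (Real.pi * R ^ 2))
    {w : ℂ} {ρ : ℂ → ℝ≥0∞} (hρ : Measurable ρ)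
    (hray : ∀ θ : ℝ, ∃ l : ℝ, 0 < l ∧ (∀ s ∈ Ioo 0 l, w + s * exp (θ * I) ∈ V) ∧
      1 ≤ ∫⁻ s in Ioo 0 l, ρ (w + (s : ℝ) * exp (θ * I))) :
    ENNReal.ofReal (2 * Real.pi * (p * c ^ (p - 1))) ≤ (∫⁻ z, ρ z ^ p) +
      ENNReal.ofReal (2 * Real.pi * ((p - 1) * c ^ p *
        (R ^ ((p - 2) / (p - 1)) / ((p - 2) / (p - 1))))) := by
  have hp1 : 0 < p - 1 := by linarith
  have hp2 : 0 < p - 2 := by linarith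
  have hray' := fun (θ l : ℝ) (hl : 0 < l) => ray_inequality hp hc hR hl
    (g := fun s : ℝ => ρ (w + s * exp (θ * I))) (by fun_prop)
  set b := (p - 2) / (p - 1) with hbdef
  have hb : 0 < b := by positivity
  have hb1 : b < 1 := by rw [hbdef, div_lt_one hp1]; linarith
  have hbb : 0 ≤ 1 / b - 1 / 2 := by
    have : 1 ≤ 1 / b := by rw [le_div_iff₀ hb]; linarith
    linarith
  set A := (p - 1) * c ^ p with hA
  have hA0 : 0 ≤ A := by positivity
  set k := A * R ^ (b - 2) with hk
  have hk0 : 0 ≤ k := by positivity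
  set K := A * (R ^ b * (1 / b - 1 / 2)) with hK
  have hK0 : 0 ≤ K := by positivity
  set G : ℂ → ℝ≥0∞ := V.indicator fun z => ρ z ^ p + ENNReal.ofReal k with hG
  have hGm : Measurable G := Measurable.indicator (by fun_prop) hV
  have hang : ∀ C : ℝ, 0 ≤ C → ∫⁻ _ in Ioo (-Real.pi) Real.pi, ENNReal.ofReal C =
      ENNReal.ofReal (2 * Real.pi * C) := fun C hC => by
    rw [setLIntegral_const, Real.volume_Ioo, ← ENNReal.ofReal_mul hC]
    congr 1; ring
  have hpt : ∀ θ : ℝ, ENNReal.ofReal (p * c ^ (p - 1)) ≤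
      (∫⁻ s in Ioi (0 : ℝ), ENNReal.ofReal s * G (w + s * exp (θ * I))) + ENNReal.ofReal K := by
    intro θ
    obtain ⟨l, hl, hmem, h1⟩ := hray θ
    refine (hray' θ l hl h1).trans ?_
    refine add_le_add ?_ le_rfl
    calc _ = ∫⁻ s in Ioo 0 l, ENNReal.ofReal s * G (w + s * exp (θ * I)) := by
          refine setLIntegral_congr_fun measurableSet_Ioo fun s hs => ?_
          simp only [hG, indicator_of_mem (hmem s hs)]
      _ ≤ _ := lintegral_mono_set Ioo_subset_Ioi_self
  calc ENNReal.ofReal (2 * Real.pi * (p * c ^ (p - 1)))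
      = ∫⁻ _ in Ioo (-Real.pi) Real.pi, ENNReal.ofReal (p * c ^ (p - 1)) :=
        (hang _ (by positivity)).symm
    _ ≤ ∫⁻ θ in Ioo (-Real.pi) Real.pi, ((∫⁻ s in Ioi (0 : ℝ), ENNReal.ofReal s *
          G (w + s * exp ((θ : ℝ) * I))) + ENNReal.ofReal K) := lintegral_mono fun θ => hpt θ
    _ = (∫⁻ z, G z) + ENNReal.ofReal (2 * Real.pi * K) := by
        rw [lintegral_add_right _ measurable_const, hang _ hK0, lintegral_eq_polar hGm w]
    _ ≤ (∫⁻ z, ρ z ^ p) + ENNReal.ofReal k * ENNReal.ofReal (Real.pi * R ^ 2) +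
          ENNReal.ofReal (2 * Real.pi * K) := by
        gcongr
        rw [hG, lintegral_indicator hV, lintegral_add_right _ measurable_const, setLIntegral_const]
        gcongr
        exact Measure.restrict_le_self
    _ = _ := by
        rw [add_assoc, ← ENNReal.ofReal_mul hk0, ← ENNReal.ofReal_add (by positivity) (by positivity)]
        congr 2
        have e2 : R ^ (b - 2) = R ^ b / R ^ 2 := by
          rw [Real.rpow_sub hR]; norm_num
        rw [hk, hK, e2]
        field_simp
        ring

lemma lintegral_weighted_radial_le {p c b r q₀ d : ℝ} (hp : 1 < p) (hc : 0 < c) (hb : 0 < b)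
    (hbp : (b - 1) * p + 1 = b - 1) (hr0 : 0 < r) (hr : r < d) (hq₀ : 0 < q₀)
    {Q : ℂ → ℝ≥0∞} (hQ : Measurable Q) {z₀ : ℂ}
    (hq : ∀ᵐ t ∂(volume.restrict (Ioo (0 : ℝ) d)), circleMean Q z₀ t ≤ ENNReal.ofReal q₀) :
    ∫⁻ z, Q z * ((closedBall z₀ r).indicator
        (fun z => ENNReal.ofReal (c * ‖z - z₀‖ ^ (b - 1))) z) ^ p ≤
      ENNReal.ofReal (2 * Real.pi * q₀ * (c ^ p * (r ^ b / b))) := by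
  have hp0 : 0 < p := by linarith
  have hm : Measurable ((closedBall z₀ r).indicator
      (fun z => ENNReal.ofReal (c * ‖z - z₀‖ ^ (b - 1)))) :=
    Measurable.indicator (by fun_prop) measurableSet_closedBall
  rw [lintegral_eq_polar_swap (by fun_prop) z₀]
  have hnorm : ∀ s θ : ℝ, 0 < s → ‖z₀ + s * exp (θ * I) - z₀‖ = s := fun s θ hs => by
    rw [add_sub_cancel_left, norm_mul, Complex.norm_exp_ofReal_mul_I, mul_one, Complex.norm_real,
      Real.norm_of_nonneg hs.le]
  have hpow : ∀ s : ℝ, 0 < s → s * (c * s ^ (b - 1)) ^ p = c ^ p * s ^ (b - 1) := fun s hs => by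
    rw [Real.mul_rpow hc.le (by positivity), ← Real.rpow_mul hs.le]
    nth_rw 2 [← hbp]
    rw [Real.rpow_add_one hs.ne']
    ring
  calc _ ≤ ∫⁻ s in Ioi (0 : ℝ), (Ioc 0 r).indicator (fun s =>
        ENNReal.ofReal (2 * Real.pi * q₀ * c ^ p) * ENNReal.ofReal (s ^ (b - 1))) s := by
        refine lintegral_mono_ae ?_
        filter_upwards [ae_restrict_of_ae ((ae_restrict_iff' measurableSet_Ioo).1 hq),
          self_mem_ae_restrict measurableSet_Ioi] with s hs hs0
        have hs0 : 0 < s := hs0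
        by_cases hsr : s ≤ r
        · rw [indicator_of_mem (show s ∈ Ioc 0 r from ⟨hs0, hsr⟩)]
          have hint : ∀ θ : ℝ, (closedBall z₀ r).indicator
              (fun z => ENNReal.ofReal (c * ‖z - z₀‖ ^ (b - 1))) (z₀ + s * exp (θ * I)) =
              ENNReal.ofReal (c * s ^ (b - 1)) := fun θ => by
            rw [indicator_of_mem, hnorm s θ hs0]
            rw [mem_closedBall, dist_eq_norm, hnorm s θ hs0]
            exact hsr
          have hmean := hs ⟨hs0, hsr.trans_lt hr⟩
          rw [circleMean, ENNReal.div_le_iff (by simp [Real.pi_pos]) ENNReal.ofReal_ne_top,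
            ← lintegral_angle_eq fun z => Q (z₀ + s * z)] at hmean
          simp_rw [hint]
          rw [lintegral_mul_const _ (by fun_prop)]
          calc _ ≤ ENNReal.ofReal s * (ENNReal.ofReal q₀ * ENNReal.ofReal (2 * Real.pi) *
                ENNReal.ofReal (c * s ^ (b - 1)) ^ p) := by gcongr
            _ = _ := by
              rw [ENNReal.ofReal_rpow_of_nonneg (by positivity) hp0.le,
                ← ENNReal.ofReal_mul (by positivity), ← ENNReal.ofReal_mul (by positivity),
                ← ENNReal.ofReal_mul (by positivity), ← ENNReal.ofReal_mul (by positivity)]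
              congr 1
              linear_combination (q₀ * (2 * Real.pi)) * hpow s hs0
        · have hint : ∀ θ : ℝ, (closedBall z₀ r).indicator
              (fun z => ENNReal.ofReal (c * ‖z - z₀‖ ^ (b - 1))) (z₀ + s * exp (θ * I)) = 0 :=
            fun θ => by
              rw [indicator_of_notMem]
              rw [mem_closedBall, dist_eq_norm, hnorm s θ hs0]
              exact hsr
          simp [hint, ENNReal.zero_rpow_of_pos hp0]
    _ = _ := by
        rw [setLIntegral_indicator measurableSet_Ioc, inter_eq_left.2 Ioc_subset_Ioi_self,
          lintegral_const_mul _ (by fun_prop), ← Measure.restrict_congr_set Ioo_ae_eq_Ioc,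
          lintegral_rpow_sub_one hb hr0.le, ← ENNReal.ofReal_mul (by positivity)]
        congr 1; ring

lemma norm_deriv_rpow_norm_sq_le {b ε : ℝ} (hb : 0 < b) (hb1 : b < 1) (hε : 0 < ε) {z₀ : ℂ}
    {γ : ℝ → ℂ} {t : ℝ} (hγ : DifferentiableAt ℝ γ t) :
    ‖deriv (fun t => (‖γ t - z₀‖ ^ 2 + ε) ^ (b / 2)) t‖ ≤
      b * ‖γ t - z₀‖ ^ (b - 1) * ‖deriv γ t‖ := by
  have h := (((hγ.hasDerivAt.sub_const z₀).norm_sq.add_const ε).rpow_const (p := b / 2)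
    (Or.inl (by positivity)))
  rw [h.deriv]
  rcases eq_or_lt_of_le (norm_nonneg (γ t - z₀)) with h0 | h0
  · have : γ t - z₀ = 0 := norm_eq_zero.1 h0.symm
    rw [this]
    simp only [inner_zero_left, mul_zero, zero_mul, norm_zero]
    positivity
  · have hin : |inner ℝ (γ t - z₀) (deriv γ t)| ≤ ‖γ t - z₀‖ * ‖deriv γ t‖ :=
      abs_real_inner_le_norm _ _
    set n := ‖γ t - z₀‖
    have hpow : (n ^ 2 + ε) ^ (b / 2 - 1) ≤ n ^ (b - 1) / n := by
      have e : n ^ (b - 1) / n = (n ^ 2) ^ (b / 2 - 1) := by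
        rw [← Real.rpow_natCast, ← Real.rpow_mul h0.le, ← Real.rpow_sub_one h0.ne']
        congr 1; push_cast; ring
      rw [e]
      exact Real.rpow_le_rpow_of_nonpos (by positivity) (by linarith) (by linarith)
    simp only [Real.norm_eq_abs, abs_mul, abs_two]
    rw [abs_of_pos (by positivity : 0 < b / 2),
      abs_of_nonneg (by positivity : 0 ≤ (n ^ 2 + ε) ^ (b / 2 - 1))]
    calc _ ≤ 2 * (n * ‖deriv γ t‖) * (b / 2) * (n ^ (b - 1) / n) := by gcongr
      _ = _ := by field_simp

lemma ofReal_sub_le_lintegral_radial {b ε r : ℝ} (hb : 0 < b) (hb1 : b < 1) (hε : 0 < ε)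
    {z₀ : ℂ} {γ : ℝ → ℂ} {L : NNReal} (hγ : LipschitzOnWith L γ (Icc 0 1))
    (hmem : ∀ t ∈ Icc (0 : ℝ) 1, γ t ∈ closedBall z₀ r) (h0 : γ 0 = z₀) (h1 : ‖γ 1 - z₀‖ = r) :
    ENNReal.ofReal ((r ^ 2 + ε) ^ (b / 2) - ε ^ (b / 2)) ≤
      ∫⁻ t in Icc (0 : ℝ) 1, ENNReal.ofReal (b * ‖γ t - z₀‖ ^ (b - 1)) * ‖deriv γ t‖ₑ := by
  set G : ℂ → ℝ := fun z => (‖z - z₀‖ ^ 2 + ε) ^ (b / 2)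
  have hG : ContDiff ℝ 1 G := by
    refine ContDiff.rpow_const_of_ne ?_ fun z => by positivity
    exact ((contDiff_id.sub contDiff_const).norm_sq ℝ).add contDiff_const
  obtain ⟨M, hM⟩ := hG.contDiffOn.exists_lipschitzOnWith one_ne_zero
    (convex_closedBall z₀ r) (isCompact_closedBall z₀ r)
  have hGγ : LipschitzOnWith (M * L) (G ∘ γ) (uIcc 0 1) := by
    rw [uIcc_of_le zero_le_one]
    exact hM.comp hγ hmem
  have hftc := hGγ.absolutelyContinuousOnInterval.integral_deriv_eq_sub
  have e0 : (G ∘ γ) 0 = ε ^ (b / 2) := by simp [G, h0]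
  have e1 : (G ∘ γ) 1 = (r ^ 2 + ε) ^ (b / 2) := by simp [G, h1]
  rw [e0, e1, intervalIntegral.integral_of_le zero_le_one, ← integral_Icc_eq_integral_Ioc] at hftc
  rw [← hftc]
  refine (Real.ofReal_le_enorm _).trans ((enorm_integral_le_lintegral_enorm _).trans ?_)
  rw [Measure.restrict_congr_set Ioo_ae_eq_Icc.symm]
  refine lintegral_mono_ae ?_
  filter_upwards [ae_restrict_of_ae hγ.ae_differentiableWithinAt_of_mem_real,
    self_mem_ae_restrict measurableSet_Ioo] with t ht ht01
  have hd := (ht (Ioo_subset_Icc_self ht01)).differentiableAt (Icc_mem_nhds ht01.1 ht01.2)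
  rw [← ofReal_norm, ← ofReal_norm, ← ENNReal.ofReal_mul (by positivity)]
  exact ENNReal.ofReal_le_ofReal (norm_deriv_rpow_norm_sq_le hb hb1 hε hd)

lemma one_le_lineIntegral_radial {b r : ℝ} (hb : 0 < b) (hb1 : b < 1) (hr : 0 < r)
    {z₀ : ℂ} {γ : ℝ → ℂ}
    (hmem : ∀ t ∈ Icc (0 : ℝ) 1, γ t ∈ closedBall z₀ r) (h0 : γ 0 = z₀) (h1 : ‖γ 1 - z₀‖ = r) :
    1 ≤ lineIntegral ((closedBall z₀ r).indicator
      (fun z => ENNReal.ofReal (b * r ^ (-b) * ‖z - z₀‖ ^ (b - 1)))) γ := by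
  rw [lineIntegral]
  split_ifs with h
  swap
  · exact le_top
  obtain ⟨L, hL⟩ := h
  have hlim : Filter.Tendsto (fun ε : ℝ => ENNReal.ofReal (r ^ (-b)) *
      ENNReal.ofReal ((r ^ 2 + ε) ^ (b / 2) - ε ^ (b / 2))) (nhdsWithin 0 (Ioi 0)) (nhds 1) := by
    have hc : Continuous fun ε : ℝ => ENNReal.ofReal (r ^ (-b) *
        ((r ^ 2 + ε) ^ (b / 2) - ε ^ (b / 2))) := by
      refine ENNReal.continuous_ofReal.comp (continuous_const.mul ?_)
      exact ((Real.continuous_rpow_const (by positivity)).comp (by fun_prop)).sub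
        (Real.continuous_rpow_const (by positivity))
    have h := (hc.tendsto 0).mono_left (nhdsWithin_le_nhds (s := Ioi 0))
    have e : r ^ (-b) * ((r ^ 2 + 0) ^ (b / 2) - 0 ^ (b / 2)) = 1 := by
      rw [Real.zero_rpow (by positivity), add_zero, sub_zero, ← Real.rpow_natCast,
        ← Real.rpow_mul hr.le, ← Real.rpow_add hr]
      push_cast
      rw [show -b + 2 * (b / 2) = 0 by ring, Real.rpow_zero]
    rw [e, ENNReal.ofReal_one] at h
    simpa only [← ENNReal.ofReal_mul (Real.rpow_nonneg hr.le (-b))] using h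
  refine le_of_tendsto hlim ?_
  filter_upwards [self_mem_nhdsWithin] with ε hε
  calc _ ≤ ENNReal.ofReal (r ^ (-b)) * ∫⁻ t in Icc (0 : ℝ) 1,
        ENNReal.ofReal (b * ‖γ t - z₀‖ ^ (b - 1)) * ‖deriv γ t‖ₑ := by
        gcongr
        exact ofReal_sub_le_lintegral_radial hb hb1 hε hL hmem h0 h1
    _ = ∫⁻ t in Icc (0 : ℝ) 1, ENNReal.ofReal (r ^ (-b)) *
        (ENNReal.ofReal (b * ‖γ t - z₀‖ ^ (b - 1)) * ‖deriv γ t‖ₑ) :=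
        (lintegral_const_mul' _ _ ENNReal.ofReal_ne_top).symm
    _ = _ := by
        refine setLIntegral_congr_fun measurableSet_Icc fun t ht => ?_
        simp only [indicator_of_mem (hmem t ht)]
        rw [← mul_assoc, ← ENNReal.ofReal_mul (by positivity), enorm_eq_nnnorm]
        congr 2; ring

lemma ball_subset_of_le_infDist_frontier {D : Set ℂ} (hD : IsOpen D) {z₀ : ℂ} (hz₀ : z₀ ∈ D) :
    ball z₀ (infDist z₀ (frontier D)) ⊆ D := by
  intro z hz
  have hpos : 0 < infDist z₀ (frontier D) := dist_nonneg.trans_lt hz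
  have hdisj : Disjoint (ball z₀ (infDist z₀ (frontier D))) (frontier D) := disjoint_ball_infDist
  have hpre : IsPreconnected (ball z₀ (infDist z₀ (frontier D))) :=
    (convex_ball _ _).isPreconnected
  refine hpre.subset_of_closure_inter_subset hD ⟨z₀, mem_ball_self hpos, hz₀⟩ ?_ hz
  rintro y ⟨hy1, hy2⟩
  by_contra hyD
  refine Set.disjoint_left.1 hdisj hy2 ⟨hy1, ?_⟩
  rwa [hD.interior_eq]

lemma continuousOn_invFunOn_of_isCompact {f : ℂ → ℂ} {K : Set ℂ} (hK : IsCompact K)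
    (hf : ContinuousOn f K) (hinj : InjOn f K) :
    ContinuousOn (Function.invFunOn f K) (f '' K) := by
  rw [continuousOn_iff_isClosed]
  intro C hC
  refine ⟨f '' (K ∩ C), ((hK.inter_right hC).image_of_continuousOn
    (hf.mono inter_subset_left)).isClosed, ?_⟩
  ext y
  constructor
  · rintro ⟨hy, x, hx, rfl⟩
    rw [mem_preimage, hinj.leftInvOn_invFunOn hx] at hy
    exact ⟨⟨x, ⟨hx, hy⟩, rfl⟩, x, hx, rfl⟩
  · rintro ⟨⟨x, ⟨hx, hxC⟩, rfl⟩, h⟩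
    refine ⟨?_, h⟩
    rwa [mem_preimage, hinj.leftInvOn_invFunOn hx]

lemma lineIntegral_of_eqOn_segment {ρ : ℂ → ℝ≥0∞} {γ : ℝ → ℂ} {w e : ℂ} {l : ℝ} (hl : 0 < l)
    (he : ‖e‖ = 1) (h : ∀ t ∈ Icc (0 : ℝ) 1, γ t = w + ((l * t : ℝ) : ℂ) * e) :
    lineIntegral ρ γ = ∫⁻ s in Ioo 0 l, ρ (w + (s : ℝ) * e) := by
  have hlip : LipschitzOnWith ⟨l, hl.le⟩ γ (Icc 0 1) := by
    refine LipschitzOnWith.of_dist_le_mul fun x hx y hy => ?_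
    rw [h x hx, h y hy, dist_add_left, dist_eq_norm, ← sub_mul, norm_mul, he, mul_one,
      ← Complex.ofReal_sub, Complex.norm_real, ← mul_sub, norm_mul, Real.norm_of_nonneg hl.le,
      dist_eq_norm]
    rfl
  rw [lineIntegral, if_pos ⟨_, hlip⟩, Measure.restrict_congr_set Ioo_ae_eq_Icc.symm]
  have himg : (fun t : ℝ => l * t) '' Ioo 0 1 = Ioo 0 l := by
    rw [Set.image_mul_left_Ioo hl]; simp
  rw [← himg, lintegral_image_eq_lintegral_abs_deriv_mul (f' := fun _ => l) measurableSet_Ioo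
    (fun t _ => by simpa using ((hasDerivAt_id t).const_mul l).hasDerivWithinAt)
    (fun x _ y _ hxy => mul_left_cancel₀ hl.ne' hxy)]
  refine setLIntegral_congr_fun measurableSet_Ioo fun t ht => ?_
  have hd : HasDerivAt (fun t : ℝ => w + ((l * t : ℝ) : ℂ) * e) (((l * 1 : ℝ) : ℂ) * e) t :=
    ((((hasDerivAt_id t).const_mul l).ofReal_comp).mul_const e).const_add w
  have hderiv : deriv γ t = (l : ℂ) * e := by
    rw [Filter.EventuallyEq.deriv_eq (f₁ := γ) (f := fun t : ℝ => w + ((l * t : ℝ) : ℂ) * e)]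
    · simpa using hd.deriv
    · filter_upwards [Icc_mem_nhds ht.1 ht.2] with s hs using h s hs
  rw [h t (Ioo_subset_Icc_self ht), hderiv, mul_comm, ← enorm_eq_nnnorm, ← ofReal_norm, norm_mul,
    he, mul_one, Complex.norm_real, Real.norm_eq_abs]

lemma exists_ray_of_isAdmissible {D : Set ℂ} {f : ℂ → ℂ} (hf : IsHomeoOn f D) {z₀ : ℂ} {r : ℝ}
    (hr : 0 < r) (hD : closedBall z₀ r ⊆ D) {ρ : ℂ → ℝ≥0∞}
    (hρ : IsAdmissible ρ ((fun γ => f ∘ γ) '' {γ : ℝ → ℂ | ContinuousOn γ (Icc 0 1) ∧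
      (∀ t ∈ Icc (0 : ℝ) 1, γ t ∈ closedBall z₀ r) ∧ γ 0 = z₀ ∧ ‖γ 1 - z₀‖ = r})) (θ : ℝ) :
    ∃ l : ℝ, 0 < l ∧ (∀ s ∈ Ioo 0 l, f z₀ + s * exp (θ * I) ∈ f '' ball z₀ r) ∧
      1 ≤ ∫⁻ s in Ioo 0 l, ρ (f z₀ + (s : ℝ) * exp (θ * I)) := by
  obtain ⟨hfc, hfi, hfo⟩ := hf
  have hbD : ball z₀ r ⊆ D := ball_subset_closedBall.trans hD
  have hVo : IsOpen (f '' ball z₀ r) := hfo _ hbD isOpen_ball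
  have hK : IsCompact (f '' closedBall z₀ r) :=
    (isCompact_closedBall z₀ r).image_of_continuousOn (hfc.mono hD)
  have hVK : f '' ball z₀ r ⊆ f '' closedBall z₀ r := image_mono ball_subset_closedBall
  have hz₀ : z₀ ∈ closedBall z₀ r := mem_closedBall_self hr.le
  have hinj : InjOn f (closedBall z₀ r) := hfi.mono hD
  set e : ℂ := exp (θ * I)
  have he : ‖e‖ = 1 := Complex.norm_exp_ofReal_mul_I θ
  obtain ⟨l, hl, hin, hout⟩ := exists_first_exit_s2 hVo (hK.isBounded.subset hVK)
    (mem_image_of_mem f (mem_ball_self hr)) he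
  refine ⟨l, hl, fun s hs => hin s ⟨hs.1.le, hs.2⟩, ?_⟩
  have hmem : ∀ s ∈ Icc 0 l, f z₀ + s * e ∈ f '' closedBall z₀ r := by
    have hcl : IsClosed ((fun s : ℝ => f z₀ + s * e) ⁻¹' (f '' closedBall z₀ r)) :=
      hK.isClosed.preimage (by fun_prop)
    have := hcl.closure_subset_iff.2 fun s hs => hVK (hin s hs)
    rwa [closure_Ico hl.ne] at this
  set σ : ℝ → ℂ := fun t => f z₀ + ((l * t : ℝ) : ℂ) * e with hσ
  have hσmem : ∀ t ∈ Icc (0 : ℝ) 1, σ t ∈ f '' closedBall z₀ r := fun t ht =>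
    hmem _ ⟨mul_nonneg hl.le ht.1, mul_le_of_le_one_right hl.le ht.2⟩
  set g := Function.invFunOn f (closedBall z₀ r)
  have hgmem : ∀ t ∈ Icc (0 : ℝ) 1, g (σ t) ∈ closedBall z₀ r := fun t ht =>
    Function.invFunOn_mem (hσmem t ht)
  have hfg : ∀ t ∈ Icc (0 : ℝ) 1, f (g (σ t)) = σ t := fun t ht =>
    Function.invFunOn_eq (hσmem t ht)
  have hadm := hρ.2 (f ∘ (g ∘ σ)) ⟨g ∘ σ, ⟨?_, hgmem, ?_, ?_⟩, rfl⟩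
  · rwa [lineIntegral_of_eqOn_segment (γ := f ∘ (g ∘ σ)) hl he hfg] at hadm
  · exact (continuousOn_invFunOn_of_isCompact (isCompact_closedBall z₀ r) (hfc.mono hD) hinj).comp
      (by fun_prop) hσmem
  · have : σ 0 = f z₀ := by simp [hσ]
    rw [Function.comp_apply, this]
    exact hinj.leftInvOn_invFunOn hz₀
  · have h1 : (1 : ℝ) ∈ Icc (0 : ℝ) 1 := right_mem_Icc.2 zero_le_one
    have hle := hgmem 1 h1
    rw [mem_closedBall, dist_eq_norm] at hle
    refine hle.antisymm (not_lt.1 fun hlt => hout ?_)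
    refine ⟨g (σ 1), by rwa [mem_ball, dist_eq_norm], ?_⟩
    rw [hfg 1 h1]
    simp [hσ]

lemma rpow_mul_sq_le_sq {p q₀ b r R : ℝ} (hp : 2 < p) (hq₀ : 0 < q₀) (hr : 0 < r) (hR : 0 < R)
    (hb : 0 < b) (hbp : b * (p - 1) = p - 2)
    (h : (b * R ^ (-b)) ^ (p - 1) ≤ q₀ * (b * r ^ (-b)) ^ (p - 1)) :
    q₀ ^ (2 / (2 - p)) * r ^ 2 ≤ R ^ 2 := by
  have hpow : ∀ x : ℝ, 0 < x → (b * x ^ (-b)) ^ (p - 1) = b ^ (p - 1) * x ^ (2 - p) :=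
    fun x hx => by
      rw [Real.mul_rpow hb.le (by positivity), ← Real.rpow_mul hx.le]
      congr 2
      linarith
  rw [hpow R hR, hpow r hr] at h
  have h' : R ^ (2 - p) ≤ q₀ * r ^ (2 - p) := by
    have : 0 < b ^ (p - 1) := by positivity
    refine le_of_mul_le_mul_left ?_ this
    linarith
  have hexp : 2 / (2 - p) ≤ 0 := div_nonpos_of_nonneg_of_nonpos two_pos.le (by linarith)
  have hsq : ∀ x : ℝ, 0 < x → (x ^ (2 - p)) ^ (2 / (2 - p)) = x ^ 2 := fun x hx => by
    rw [← Real.rpow_mul hx.le, mul_div_cancel₀ _ (by linarith : 2 - p ≠ 0), Real.rpow_two]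
  have h2 := Real.rpow_le_rpow_of_nonpos (by positivity) h' hexp
  rwa [Real.mul_rpow hq₀.le (by positivity), hsq r hr, hsq R hR] at h2

/-- **Corollary 2.** If `q_{z₀}(t) ≤ q₀ < ∞` for a.e. `t ∈ (0, d₀)`, then
`|fB(z₀,r)| ≥ q₀^{2/(2-p)} |B(z₀,r)|` for all `r ∈ (0, d₀)`. -/
theorem area_image_disc_lower_bound_const
    (p : ℝ) (hp : 2 < p) (D D' : Set ℂ)
    (hDo : IsOpen D) (hDc : IsConnected D) (hDb : Bornology.IsBounded D)
    (hD'o : IsOpen D') (hD'c : IsConnected D') (hD'b : Bornology.IsBounded D')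
    (Q : ℂ → ℝ≥0∞) (hQmeas : Measurable Q)
    (f : ℂ → ℂ) (hf : IsQHomeo p D Q f) (hfD : f '' D = D')
    (z₀ : ℂ) (hz₀ : z₀ ∈ D)
    (q₀ : ℝ) (hq₀ : 0 < q₀)
    (hq : ∀ᵐ t ∂(volume.restrict (Set.Ioo (0 : ℝ) (Metric.infDist z₀ (frontier D)))),
      circleMean Q z₀ t ≤ ENNReal.ofReal q₀)
    (r : ℝ) (hr0 : 0 < r) (hr : r < Metric.infDist z₀ (frontier D)) :
    ENNReal.ofReal (q₀ ^ (2 / (2 - p))) * volume (Metric.closedBall z₀ r) ≤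
      volume (f '' Metric.closedBall z₀ r) := by
  have hp1 : 0 < p - 1 := by linarith
  have hp2 : 0 < p - 2 := by linarith
  obtain ⟨b, hbdef⟩ : ∃ b, b = (p - 2) / (p - 1) := ⟨_, rfl⟩
  have hb : 0 < b := by rw [hbdef]; positivity
  have hb1 : b < 1 := by rw [hbdef, div_lt_one hp1]; linarith
  have hbp : b * (p - 1) = p - 2 := by rw [hbdef]; field_simp
  have hBD : closedBall z₀ r ⊆ D :=
    (closedBall_subset_ball hr).trans (ball_subset_of_le_infDist_frontier hDo hz₀)
  have hVo : IsOpen (f '' ball z₀ r) :=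
    hf.1.2.2 _ (ball_subset_closedBall.trans hBD) isOpen_ball
  have hVK : f '' ball z₀ r ⊆ f '' closedBall z₀ r := image_mono ball_subset_closedBall
  have hK : IsCompact (f '' closedBall z₀ r) :=
    (isCompact_closedBall z₀ r).image_of_continuousOn (hf.1.1.mono hBD)
  have hpos : 0 < volume (f '' closedBall z₀ r) :=
    (hVo.measure_pos volume ⟨f z₀, mem_image_of_mem f (mem_ball_self hr0)⟩).trans_le
      (measure_mono hVK)
  have hfin : volume (f '' closedBall z₀ r) ≠ ⊤ := hK.measure_lt_top.ne
  obtain ⟨R, hR, hvol⟩ : ∃ R : ℝ, 0 < R ∧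
      volume (f '' closedBall z₀ r) = ENNReal.ofReal (Real.pi * R ^ 2) := by
    have := ENNReal.toReal_pos hpos.ne' hfin
    refine ⟨√((volume (f '' closedBall z₀ r)).toReal / Real.pi), by positivity, ?_⟩
    rw [Real.sq_sqrt (by positivity), mul_div_cancel₀ _ Real.pi_ne_zero,
      ENNReal.ofReal_toReal hfin]
  set Γ : Set (ℝ → ℂ) := {γ | ContinuousOn γ (Icc 0 1) ∧
    (∀ t ∈ Icc (0 : ℝ) 1, γ t ∈ closedBall z₀ r) ∧ γ 0 = z₀ ∧ ‖γ 1 - z₀‖ = r} with hΓ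
  have hcancel : ∀ x : ℝ, 0 < x → (b * x ^ (-b)) ^ p * (x ^ b / b) = (b * x ^ (-b)) ^ (p - 1) :=
    fun x hx => by
      have h1 : b * x ^ (-b) * (x ^ b / b) = 1 := by
        have : x ^ (-b) * x ^ b = 1 := by rw [← Real.rpow_add hx]; simp
        field_simp
        linarith
      have h2 : (b * x ^ (-b)) ^ p = (b * x ^ (-b)) ^ (p - 1) * (b * x ^ (-b)) := by
        rw [← Real.rpow_add_one (by positivity), sub_add_cancel]
      rw [h2, mul_assoc, h1, mul_one]
  have hupper : pModulus p ((fun γ => f ∘ γ) '' Γ) ≤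
      ENNReal.ofReal (2 * Real.pi * q₀ * (b * r ^ (-b)) ^ (p - 1)) := by
    refine (hf.2 Γ (fun γ hγ => ⟨hγ.1, fun t ht => hBD (hγ.2.1 t ht)⟩)
      ((closedBall z₀ r).indicator fun z => ENNReal.ofReal (b * r ^ (-b) * ‖z - z₀‖ ^ (b - 1)))
      ⟨Measurable.indicator (by fun_prop) measurableSet_closedBall, fun γ hγ =>
        one_le_lineIntegral_radial hb hb1 hr0 hγ.2.1 hγ.2.2.1 hγ.2.2.2⟩).trans ?_
    refine (setLIntegral_le_lintegral _ _).trans ?_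
    rw [← hcancel r hr0]
    exact lintegral_weighted_radial_le (by linarith) (by positivity) hb (by linarith) hr0 hr hq₀
      hQmeas hq
  have hlower : ENNReal.ofReal (2 * Real.pi * (b * R ^ (-b)) ^ (p - 1)) ≤
      pModulus p ((fun γ => f ∘ γ) '' Γ) := by
    refine le_iInf₂ fun ρ hρ => ?_
    have h := lintegral_rpow_lower_bound (c := b * R ^ (-b)) hp (by positivity) hR
      hVo.measurableSet ((measure_mono hVK).trans hvol.le) hρ.1
      (exists_ray_of_isAdmissible hf.1 hr0 hBD hρ)
    rw [← hbdef, mul_assoc (p - 1), hcancel R hR, show 2 * Real.pi * (p * (b * R ^ (-b)) ^ (p - 1)) =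
      2 * Real.pi * (b * R ^ (-b)) ^ (p - 1) + 2 * Real.pi * ((p - 1) * (b * R ^ (-b)) ^ (p - 1)) by
        ring, ENNReal.ofReal_add (by positivity) (by positivity)] at h
    exact ENNReal.le_of_add_le_add_right ENNReal.ofReal_ne_top h
  have hle := (ENNReal.ofReal_le_ofReal_iff (by positivity)).1 (hlower.trans hupper)
  rw [mul_assoc (2 * Real.pi)] at hle
  have hfinal := rpow_mul_sq_le_sq hp hq₀ hr0 hR hb hbp
    (le_of_mul_le_mul_left hle Real.two_pi_pos)
  have hball : volume (closedBall z₀ r) = ENNReal.ofReal (Real.pi * r ^ 2) := by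
    rw [Complex.volume_closedBall, mul_comm, ENNReal.ofReal_mul Real.pi_pos.le,
      ENNReal.ofReal_pow hr0.le]
    congr 1
    rw [← ENNReal.ofReal_coe_nnreal, NNReal.coe_real_pi]
  rw [hvol, hball, ← ENNReal.ofReal_mul (by positivity)]
  refine ENNReal.ofReal_le_ofReal ?_
  calc _ = Real.pi * (q₀ ^ (2 / (2 - p)) * r ^ 2) := by ring
    _ ≤ _ := by gcongr
end
end
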